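/- Let χ₁ be a real-valued, even, nonprincipal, primitive Dirichlet character modulo N > 1. Let q be a prime, h an integer with 0 < h < q, and ρ a real number with ρ > 1. Then, as the real variable x → ∞, Σ_{n ≤ x} (x² − n²)^ρ Σ_{r | n} d_{χ₁}(n/r) cos(2πrh/q) = −(√π · Γ(ρ+1) · L(1,χ₁))/(2Γ(ρ+3/2)) · log(2 sin(πh/q)) · x^{1+2ρ} + O(x^{(5ρ+1)/3}). -/

import Mathlib

open scoped Real Classical
open Filter Asymptotics

/-- `d_χ(n) = ∑_{k ∣ n} χ(k)`. -/
noncomputable def divisorSumChar {N : ℕ} (χ : DirichletCharacter ℂ N) (n : ℕ) : ℂ :=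
  ∑ k ∈ n.divisors, χ (k : ZMod N)

open scoped Topology

open MeasureTheory Complex in
/-- First derivative test of van der Corput. -/
theorem norm_integral_exp_I_le {g g' g'' : ℝ → ℝ} {a b m : ℝ} (hab : a ≤ b) (hm : 0 < m)
    (hg : ∀ x ∈ Set.Icc a b, HasDerivAt g (g' x) x)
    (hg' : ∀ x ∈ Set.Icc a b, HasDerivAt g' (g'' x) x)
    (hc : ContinuousOn g'' (Set.Icc a b))
    (hlow : ∀ x ∈ Set.Icc a b, m ≤ |g' x|)
    (hsign : (∀ x ∈ Set.Icc a b, 0 ≤ g'' x) ∨ ∀ x ∈ Set.Icc a b, g'' x ≤ 0) :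
    ‖∫ x in a..b, cexp (I * g x)‖ ≤ 4 / m := by
  have hu : Set.uIcc a b = Set.Icc a b := Set.uIcc_of_le hab
  have hne : ∀ x ∈ Set.Icc a b, g' x ≠ 0 := fun x hx h0 => by
    have := hlow x hx
    rw [h0, abs_zero] at this
    linarith
  have hgc : ContinuousOn g (Set.Icc a b) := fun x hx => (hg x hx).continuousAt.continuousWithinAt
  have hgc' : ContinuousOn g' (Set.Icc a b) :=
    fun x hx => (hg' x hx).continuousAt.continuousWithinAt
  have hinv : ∀ x ∈ Set.Icc a b, HasDerivAt (fun x => (g' x)⁻¹) (-g'' x / g' x ^ 2) x :=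
    fun x hx => (hg' x hx).inv (hne x hx)
  have hcq : ContinuousOn (fun x => -g'' x / g' x ^ 2) (Set.Icc a b) :=
    hc.neg.div (hgc'.pow 2) fun x hx => pow_ne_zero _ (hne x hx)
  have hparts := intervalIntegral.integral_mul_deriv_eq_deriv_mul (a := a) (b := b)
    (u := fun x => (-I) * (((g' x)⁻¹ : ℝ) : ℂ)) (v := fun x => cexp (I * g x))
    (u' := fun x => (-I) * ((-g'' x / g' x ^ 2 : ℝ) : ℂ))
    (v' := fun x => cexp (I * g x) * (I * g' x))
    (fun x hx => ((hinv x (hu ▸ hx)).ofReal_comp).const_mul (-I))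
    (fun x hx => (((hg x (hu ▸ hx)).ofReal_comp).const_mul I).cexp)
    (by
      apply ContinuousOn.intervalIntegrable
      rw [hu]
      exact continuousOn_const.mul (continuous_ofReal.comp_continuousOn hcq))
    (by
      apply ContinuousOn.intervalIntegrable
      rw [hu]
      exact ((continuousOn_const.mul (continuous_ofReal.comp_continuousOn hgc)).cexp).mul
        (continuousOn_const.mul (continuous_ofReal.comp_continuousOn hgc')))
  have hL : (∫ x in a..b, (-I) * (((g' x)⁻¹ : ℝ) : ℂ) * (cexp (I * g x) * (I * g' x)))
      = ∫ x in a..b, cexp (I * g x) := by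
    apply intervalIntegral.integral_congr
    intro x hx
    have h1 : (g' x : ℂ) ≠ 0 := by exact_mod_cast hne x (hu ▸ hx)
    have : (-I) * (((g' x)⁻¹ : ℝ) : ℂ) * (cexp (I * g x) * (I * g' x))
      = (-(I * I)) * ((g' x : ℂ)⁻¹ * g' x) * cexp (I * g x) := by push_cast; ring
    simp only [this, I_mul_I, inv_mul_cancel₀ h1, neg_neg, one_mul]
  rw [hL] at hparts
  have hnexp : ∀ y : ℝ, ‖cexp (I * y)‖ = 1 := fun y => by
    rw [mul_comm]; exact norm_exp_ofReal_mul_I y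
  have hb : ∀ x ∈ Set.Icc a b, |(g' x)⁻¹| ≤ 1 / m := fun x hx => by
    rw [abs_inv, ← one_div]
    exact one_div_le_one_div_of_le hm (hlow x hx)
  have hint : ∫ x in a..b, (-g'' x / g' x ^ 2) = (g' b)⁻¹ - (g' a)⁻¹ := by
    apply intervalIntegral.integral_eq_sub_of_hasDerivAt
    · intro x hx; exact hinv x (hu ▸ hx)
    · apply ContinuousOn.intervalIntegrable
      rw [hu]; exact hcq
  have ha' := hb a (Set.left_mem_Icc.2 hab)
  have hb' := hb b (Set.right_mem_Icc.2 hab)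
  have hV : ∫ x in a..b, |(-g'' x / g' x ^ 2)| ≤ 2 / m := by
    have key : ∫ x in a..b, |(-g'' x / g' x ^ 2)| ≤ |(g' b)⁻¹ - (g' a)⁻¹| := by
      rw [← hint]
      rcases hsign with hs | hs
      · rw [← abs_neg, ← intervalIntegral.integral_neg]
        refine le_trans (le_of_eq ?_) (le_abs_self _)
        apply intervalIntegral.integral_congr
        intro x hx
        have := hs x (hu ▸ hx)
        simp only [neg_div, abs_neg, neg_neg]
        exact abs_of_nonneg (by positivity)
      · refine le_trans (le_of_eq ?_) (le_abs_self _)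
        apply intervalIntegral.integral_congr
        intro x hx
        have := hs x (hu ▸ hx)
        exact abs_of_nonneg (div_nonneg (by linarith) (by positivity))
    calc _ ≤ |(g' b)⁻¹ - (g' a)⁻¹| := key
      _ ≤ |(g' b)⁻¹| + |(g' a)⁻¹| := abs_sub _ _
      _ ≤ 2 / m := by rw [show 2 / m = 1 / m + 1 / m by ring]; linarith
  rw [hparts]
  have hI2 : ‖∫ x in a..b, (-I) * ((-g'' x / g' x ^ 2 : ℝ) : ℂ) * cexp (I * g x)‖ ≤ 2 / m := by
    refine le_trans (intervalIntegral.norm_integral_le_integral_norm hab) ?_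
    refine le_trans (le_of_eq ?_) hV
    apply intervalIntegral.integral_congr
    intro x _
    simp only [norm_mul, norm_neg, norm_I, one_mul, hnexp, mul_one, Complex.norm_real,
      Real.norm_eq_abs]
  have hB : ∀ x ∈ Set.Icc a b, ‖(-I) * (((g' x)⁻¹ : ℝ) : ℂ) * cexp (I * g x)‖ ≤ 1 / m := by
    intro x hx
    rw [norm_mul, norm_mul, norm_neg, norm_I, one_mul, hnexp, mul_one, Complex.norm_real]
    exact hb x hx
  calc _ ≤ ‖(-I) * (((g' b)⁻¹ : ℝ) : ℂ) * cexp (I * g b) -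
          (-I) * (((g' a)⁻¹ : ℝ) : ℂ) * cexp (I * g a)‖ + _ := norm_sub_le _ _
    _ ≤ (1 / m + 1 / m) + 2 / m := by
        refine add_le_add (le_trans (norm_sub_le _ _) (add_le_add ?_ ?_)) hI2
        · exact hB b (Set.right_mem_Icc.2 hab)
        · exact hB a (Set.left_mem_Icc.2 hab)
    _ = 4 / m := by ring

theorem norm_integral_clip_le {E : Type*} [NormedAddCommGroup E] [NormedSpace ℝ E] (f : ℝ → E)
    {A B p p' K : ℝ} (hAB : A ≤ B) (hpp : p ≤ p') (hK : 0 ≤ K)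
    (h : ∀ a b, A ≤ a → a ≤ b → p ≤ a → b ≤ p' → ‖∫ x in a..b, f x‖ ≤ K) :
    ‖∫ x in (max A (min p B))..(max A (min p' B)), f x‖ ≤ K := by
  have hle : max A (min p B) ≤ max A (min p' B) := max_le_max le_rfl (min_le_min hpp le_rfl)
  rcases hle.eq_or_lt with heq | hlt
  · rw [heq, intervalIntegral.integral_same, norm_zero]; exact hK
  · refine h _ _ (le_max_left _ _) hle ?_ ?_
    · rcases le_total p B with hpB | hpB
      · rw [min_eq_left hpB]; exact le_max_right _ _
      · rw [min_eq_right hpB, max_eq_right hAB, min_eq_right (hpB.trans hpp),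
          max_eq_right hAB] at hlt
        exact absurd hlt (lt_irrefl _)
    · rcases le_total p' A with hpA | hpA
      · rw [max_eq_left ((min_le_left p' B).trans hpA)] at hlt
        exact absurd hlt (not_lt.2 (le_max_left _ _))
      · exact max_le hpA (min_le_left _ _)

open MeasureTheory Complex in
theorem norm_integral_exp_sq_log_le {w₀ A B : ℝ} (hw : 0 < w₀) (hA : 1 ≤ A) (hAB : A ≤ B) :
    ‖∫ w in A..B, cexp (I * ((-6 * w ^ 2 * (2 * Real.log (w / w₀) - 1) : ℝ) : ℂ))‖ ≤ 5 := by
  set f : ℝ → ℂ := fun w => cexp (I * ((-6 * w ^ 2 * (2 * Real.log (w / w₀) - 1) : ℝ) : ℂ))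
    with hf
  have hlog : ∀ x : ℝ, 0 < x → HasDerivAt (fun w => Real.log (w / w₀)) (1 / x) x := by
    intro x hx
    have := ((hasDerivAt_id' x).div_const w₀).log (by positivity)
    convert this using 1
    field_simp
  have hd1 : ∀ x : ℝ, 0 < x → HasDerivAt (fun w => -6 * w ^ 2 * (2 * Real.log (w / w₀) - 1))
      (-24 * x * Real.log (x / w₀)) x := by
    intro x hx
    have := (((hasDerivAt_id' x).fun_pow 2).const_mul (-6)).fun_mul
      (((hlog x hx).const_mul 2).sub_const 1)
    refine this.congr_deriv ?_
    field_simp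
    norm_num
    ring
  have hd2 : ∀ x : ℝ, 0 < x → HasDerivAt (fun x => -24 * x * Real.log (x / w₀))
      (-24 * (Real.log (x / w₀) + 1)) x := by
    intro x hx
    have := ((hasDerivAt_id' x).const_mul (-24)).fun_mul (hlog x hx)
    refine this.congr_deriv ?_
    field_simp
    ring
  have hc2 : ∀ a b : ℝ, 0 < a →
      ContinuousOn (fun x => -24 * (Real.log (x / w₀) + 1)) (Set.Icc a b) := by
    intro a b ha x hx
    exact (((hlog x (ha.trans_le hx.1)).continuousAt.add
      continuousAt_const).const_mul _).continuousWithinAt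
  have test : ∀ a b : ℝ, 1 ≤ a → a ≤ b → (∀ x ∈ Set.Icc a b, 4 ≤ |(-24 * x * Real.log (x / w₀))|) →
      ((∀ x ∈ Set.Icc a b, 0 ≤ -24 * (Real.log (x / w₀) + 1)) ∨
        ∀ x ∈ Set.Icc a b, -24 * (Real.log (x / w₀) + 1) ≤ 0) → ‖∫ w in a..b, f w‖ ≤ 1 := by
    intro a b ha hab h1 h2
    have := norm_integral_exp_I_le hab (by norm_num : (0 : ℝ) < 4)
      (fun x hx => hd1 x (by linarith [hx.1])) (fun x hx => hd2 x (by linarith [hx.1]))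
      (hc2 a b (by linarith)) h1 h2
    rwa [div_self (by norm_num)] at this
  have he : Real.exp 1 < 3 := Real.exp_one_lt_three
  have he0 : 0 < Real.exp 1 := Real.exp_pos 1
  set p₁ := w₀ / Real.exp 1 with hp1
  have hp1pos : 0 < p₁ := by positivity
  have hlogp1 : Real.log (p₁ / w₀) = -1 := by
    rw [hp1, div_div, mul_comm, ← div_div, div_self hw.ne', one_div, Real.log_inv, Real.log_exp]
  set p₂ := max p₁ (w₀ - 1) with hp2
  have hp12 : p₁ ≤ p₂ := le_max_left _ _
  have hp23 : p₂ ≤ w₀ + 1 := max_le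
    (by rw [hp1]; have := div_le_self hw.le (Real.one_le_exp (zero_le_one)); linarith) (by linarith)
  have hloglow : ∀ x : ℝ, 0 < x → 1 - w₀ / x ≤ Real.log (x / w₀) := by
    intro x hx
    have := Real.one_sub_inv_le_log_of_pos (show 0 < x / w₀ by positivity)
    rwa [inv_div] at this
  have hlogup : ∀ x : ℝ, 0 < x → Real.log (x / w₀) ≤ x / w₀ - 1 := fun x hx =>
    Real.log_le_sub_one_of_pos (by positivity)
  -- the four regions
  have R1 : ‖∫ w in (max A (min A B))..(max A (min (max A p₁) B)), f w‖ ≤ 1 := by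
    refine norm_integral_clip_le f hAB (le_max_left _ _) zero_le_one fun a b ha hab _ hb => ?_
    rcases le_total A p₁ with hAp | hAp
    · rw [max_eq_right hAp] at hb
      have hl : ∀ x ∈ Set.Icc a b, Real.log (x / w₀) ≤ -1 := by
        intro x hx
        rw [← hlogp1]
        have hx0 : 0 < x := by linarith [hx.1]
        apply Real.log_le_log (by positivity)
        gcongr
        exact hx.2.trans hb
      refine test a b (hA.trans ha) hab (fun x hx => ?_) (Or.inl fun x hx => ?_)
      · have h1 := hl x hx
        have h2 : 1 ≤ x := by linarith [hx.1]
        rw [le_abs]; left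
        nlinarith
      · linarith [hl x hx]
    · rw [max_eq_left hAp] at hb
      have : a = b := le_antisymm hab (hb.trans ha)
      rw [this, intervalIntegral.integral_same, norm_zero]
      exact zero_le_one
  have R2 : ‖∫ w in (max A (min p₁ B))..(max A (min p₂ B)), f w‖ ≤ 1 := by
    refine norm_integral_clip_le f hAB hp12 zero_le_one fun a b ha hab ha' hb => ?_
    rcases le_total p₁ (w₀ - 1) with hpp | hpp
    · rw [hp2, max_eq_right hpp] at hb
      refine test a b (hA.trans ha) hab (fun x hx => ?_) (Or.inr fun x hx => ?_)
      · have hx0 : 0 < x := by linarith [hx.1]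
        have hxp : w₀ ≤ 3 * x := by
          have : p₁ ≤ x := ha'.trans hx.1
          rw [hp1, div_le_iff₀ he0] at this
          nlinarith
        have hxw : x ≤ w₀ - 1 := hx.2.trans hb
        rw [le_abs]; left
        have h1 := hlogup x hx0
        have h2 : x / w₀ - 1 ≤ - (1 / w₀) := by
          rw [← sub_nonneg]
          have : -(1 / w₀) - (x / w₀ - 1) = (w₀ - 1 - x) / w₀ := by field_simp; ring
          rw [this]
          exact div_nonneg (by linarith) hw.le
        have h3 : 1 / w₀ ≤ - Real.log (x / w₀) := by linarith
        have h4 : 1 / 3 ≤ x * (1 / w₀) := by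
          rw [mul_one_div, div_le_div_iff₀ (by norm_num) hw]; linarith
        have h5 : x * (1 / w₀) ≤ x * (- Real.log (x / w₀)) :=
          mul_le_mul_of_nonneg_left h3 hx0.le
        nlinarith
      · have hx0 : 0 < x := by linarith [hx.1]
        have : -1 ≤ Real.log (x / w₀) := by
          rw [← hlogp1]
          apply Real.log_le_log (by positivity)
          gcongr
          exact ha'.trans hx.1
        linarith
    · rw [hp2, max_eq_left hpp] at hb
      have : a = b := le_antisymm hab (hb.trans ha')
      rw [this, intervalIntegral.integral_same, norm_zero]
      exact zero_le_one
  have R3 : ‖∫ w in (max A (min p₂ B))..(max A (min (w₀ + 1) B)), f w‖ ≤ 2 := by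
    refine norm_integral_clip_le f hAB hp23 zero_le_two fun a b ha hab ha' hb => ?_
    have : ‖∫ w in a..b, f w‖ ≤ 1 * |b - a| := by
      apply intervalIntegral.norm_integral_le_of_norm_le_const
      intro x _
      rw [hf]
      simp only
      rw [mul_comm]
      exact (norm_exp_ofReal_mul_I _).le
    rw [one_mul, abs_of_nonneg (by linarith)] at this
    have h2 : w₀ - 1 ≤ a := (le_max_right _ _).trans ha'
    linarith
  have R4 : ‖∫ w in (max A (min (w₀ + 1) B))..(max A (min (max B (w₀ + 1)) B)), f w‖ ≤ 1 := by
    refine norm_integral_clip_le f hAB (le_max_right _ _) zero_le_one fun a b ha hab ha' _ => ?_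
    refine test a b (hA.trans ha) hab (fun x hx => ?_) (Or.inr fun x hx => ?_)
    · have hx0 : 0 < x := by linarith [hx.1]
      have h1 := hloglow x hx0
      rw [le_abs]; right
      have h2 : x * (1 - w₀ / x) ≤ x * Real.log (x / w₀) := mul_le_mul_of_nonneg_left h1 hx0.le
      have h3 : x * (1 - w₀ / x) = x - w₀ := by field_simp
      have h4 : w₀ + 1 ≤ x := ha'.trans hx.1
      nlinarith
    · have hx0 : 0 < x := by linarith [hx.1]
      have : 0 ≤ Real.log (x / w₀) := by
        apply Real.log_nonneg
        rw [le_div_iff₀ hw]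
        linarith [hx.1]
      linarith
  have hcont : ContinuousOn f (Set.Ioi 0) := by
    intro x hx
    exact ((continuousAt_const.mul
      (Complex.continuous_ofReal.continuousAt.comp (hd1 x hx).continuousAt)).cexp)
        |>.continuousWithinAt
  have hii : ∀ a b : ℝ, A ≤ a → A ≤ b → IntervalIntegrable f volume a b := by
    intro a b ha hb
    apply ContinuousOn.intervalIntegrable
    apply hcont.mono
    intro x hx
    have : A ≤ x := (le_min ha hb).trans hx.1
    exact Set.mem_Ioi.2 (by linarith)
  have e0 : max A (min A B) = A := by simp [hAB]
  have e1 : max A (min (max A p₁) B) = max A (min p₁ B) := by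
    rcases le_total A p₁ with h | h
    · rw [max_eq_right h]
    · rw [max_eq_left h, min_eq_left hAB, max_self, max_eq_left ((min_le_left _ _).trans h)]
  have e2 : max A (min (max B (w₀ + 1)) B) = B := by simp [hAB]
  rw [e0, e1] at R1
  rw [e2] at R4
  have hA' : ∀ p, A ≤ max A p := fun p => le_max_left _ _
  rw [← intervalIntegral.integral_add_adjacent_intervals (hii A (max A (min p₁ B)) le_rfl (hA' _))
      (hii _ B (hA' _) hAB),
    ← intervalIntegral.integral_add_adjacent_intervals
      (hii (max A (min p₁ B)) (max A (min p₂ B)) (hA' _) (hA' _)) (hii _ B (hA' _) hAB),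
    ← intervalIntegral.integral_add_adjacent_intervals
      (hii (max A (min p₂ B)) (max A (min (w₀ + 1) B)) (hA' _) (hA' _)) (hii _ B (hA' _) hAB)]
  refine (norm_add_le _ _).trans ?_
  have h1 := norm_add_le (∫ w in (max A (min p₁ B))..(max A (min p₂ B)), f w)
    ((∫ w in (max A (min p₂ B))..(max A (min (w₀ + 1) B)), f w) +
      ∫ w in (max A (min (w₀ + 1) B))..B, f w)
  have h2 := norm_add_le (∫ w in (max A (min p₂ B))..(max A (min (w₀ + 1) B)), f w)
    (∫ w in (max A (min (w₀ + 1) B))..B, f w)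
  linarith

open MeasureTheory Complex in
/-- The oscillatory integral attached to a gamma factor of degree three is bounded uniformly in the
frequency. -/
theorem norm_integral_rpow_mul_exp_le (L : ℝ) {A B : ℝ} (hA : 1 ≤ A) (hAB : A ≤ B) :
    ‖∫ u in A..B, ((u ^ (-(1 / 2) : ℝ) : ℝ) : ℂ) *
      cexp (I * ((-6 * (u * Real.log u - u) + L * u : ℝ) : ℂ))‖ ≤ 10 := by
  have hB : 1 ≤ B := hA.trans hAB
  set w₀ := Real.exp (L / 12) with hw
  have hw0 : 0 < w₀ := Real.exp_pos _
  have hsA : 1 ≤ √A := by rw [Real.one_le_sqrt]; exact hA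
  have hsAB : √A ≤ √B := Real.sqrt_le_sqrt hAB
  have main := norm_integral_exp_sq_log_le hw0 hsA hsAB
  have hsub := intervalIntegral.integral_deriv_smul_comp' (a := √A) (b := √B)
    (f := fun w => w ^ 2) (f' := fun w => 2 * w)
    (g := fun u : ℝ => ((u ^ (-(1 / 2) : ℝ) : ℝ) : ℂ) *
      cexp (I * ((-6 * (u * Real.log u - u) + L * u : ℝ) : ℂ)))
    (fun x _ => by simpa using hasDerivAt_pow 2 x) (by fun_prop) (by
      rw [Set.uIcc_of_le hsAB]
      rintro u ⟨w, hw, rfl⟩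
      have hw1 : w ^ 2 ≠ 0 := by have := hsA.trans hw.1; positivity
      apply ContinuousAt.continuousWithinAt
      refine ContinuousAt.mul ?_ (ContinuousAt.cexp ?_)
      · exact continuous_ofReal.continuousAt.comp (Real.continuousAt_rpow_const _ _ (Or.inl hw1))
      · refine continuousAt_const.mul (continuous_ofReal.continuousAt.comp ?_)
        have := Real.continuousAt_log hw1
        fun_prop)
  simp only [Real.sq_sqrt (zero_le_one.trans hA), Real.sq_sqrt (zero_le_one.trans hB)] at hsub
  rw [← hsub]
  have hcongr : (∫ x in √A..√B, (2 * x) • ((fun u : ℝ => ((u ^ (-(1 / 2) : ℝ) : ℝ) : ℂ) *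
      cexp (I * ((-6 * (u * Real.log u - u) + L * u : ℝ) : ℂ))) ∘ fun w => w ^ 2) x) =
      ∫ w in √A..√B, 2 * cexp (I * ((-6 * w ^ 2 * (2 * Real.log (w / w₀) - 1) : ℝ) : ℂ)) := by
    apply intervalIntegral.integral_congr
    intro x hx
    rw [Set.uIcc_of_le hsAB] at hx
    have hx0 : 0 < x := zero_lt_one.trans_le (hsA.trans hx.1)
    have h1 : (x ^ 2) ^ (-(1 / 2) : ℝ) = x⁻¹ := by
      rw [← Real.rpow_natCast, ← Real.rpow_mul hx0.le]
      norm_num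
      exact Real.rpow_neg_one x
    have h2 : -6 * (x ^ 2 * Real.log (x ^ 2) - x ^ 2) + L * x ^ 2 =
        -6 * x ^ 2 * (2 * Real.log (x / w₀) - 1) := by
      rw [Real.log_div hx0.ne' hw0.ne', hw, Real.log_exp, Real.log_pow]
      push_cast
      ring
    simp only [Function.comp, h1, h2, real_smul]
    rw [← mul_assoc, ← ofReal_mul]
    congr 1
    rw [mul_assoc, mul_inv_cancel₀ hx0.ne', mul_one]
    norm_num
  rw [hcongr, intervalIntegral.integral_const_mul, norm_mul]
  norm_num
  norm_num at main
  linarith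

theorem Complex.norm_Gamma_le_Gamma_re {s : ℂ} (hs : 0 < s.re) :
    ‖Complex.Gamma s‖ ≤ Real.Gamma s.re := by
  rw [Complex.Gamma_eq_integral hs, Complex.GammaIntegral, Real.Gamma_eq_integral hs]
  refine (MeasureTheory.norm_integral_le_integral_norm _).trans (le_of_eq ?_)
  refine MeasureTheory.setIntegral_congr_fun measurableSet_Ioi fun x hx => ?_
  simp only [norm_mul, Complex.norm_cpow_eq_rpow_re_of_pos (show (0:ℝ) < x from hx)]
  simp [Complex.norm_exp]

theorem Real.Gamma_add_nat_add_one_le {x : ℝ} (h1 : -1 < x) (h2 : x < 2) {n : ℕ} (hn : 1 ≤ n) :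
    Real.Gamma (x + n + 1) ≤ 6 * (n : ℝ) ^ x * n.factorial := by
  have hn' : (1:ℝ) ≤ n := by exact_mod_cast hn
  have hn0 : (0:ℝ) < n := by linarith
  have hf : (0:ℝ) < n.factorial := by exact_mod_cast n.factorial_pos
  have key := Real.Gamma_mul_add_mul_le_rpow_Gamma_mul_rpow_Gamma (s := n) (t := n + 3)
    (a := (2 - x) / 3) (b := (x + 1) / 3) hn0 (by linarith) (by linarith) (by linarith) (by ring)
  have e1 : Real.Gamma n = n.factorial * (n:ℝ)⁻¹ := by
    have := Real.Gamma_nat_eq_factorial n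
    rw [Real.Gamma_add_one hn0.ne'] at this
    rw [← this]; field_simp
  have e2 : Real.Gamma (n + 3) ≤ n.factorial * (6 * (n:ℝ) ^ 2) := by
    have : Real.Gamma (n + 3) = n.factorial * ((n + 2) * (n + 1)) := by
      rw [show (n:ℝ) + 3 = (n + 1 + 1) + 1 by ring, Real.Gamma_add_one (by positivity),
        Real.Gamma_add_one (by positivity), Real.Gamma_nat_eq_factorial]
      ring
    rw [this]
    gcongr ?_ * ?_
    nlinarith
  rw [show (2 - x) / 3 * (n:ℝ) + (x + 1) / 3 * (n + 3) = x + n + 1 by ring, e1] at key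
  refine key.trans ?_
  have : Real.Gamma (n + 3) ^ ((x + 1) / 3) ≤ (n.factorial * (6 * (n:ℝ) ^ 2)) ^ ((x + 1) / 3) :=
    Real.rpow_le_rpow (Real.Gamma_pos_of_pos (by positivity)).le e2 (by linarith)
  have h6 : (6:ℝ) ^ ((x + 1) / 3) ≤ 6 := by
    conv_rhs => rw [← Real.rpow_one 6]
    exact Real.rpow_le_rpow_of_exponent_le (by norm_num) (by linarith)
  calc _ ≤ ((n.factorial : ℝ) * (n:ℝ)⁻¹) ^ ((2 - x) / 3) *
        (n.factorial * (6 * (n:ℝ) ^ 2)) ^ ((x + 1) / 3) := by gcongr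
    _ = ((n.factorial : ℝ) ^ ((2 - x) / 3) * (n.factorial : ℝ) ^ ((x + 1) / 3)) *
        ((n:ℝ) ^ (-((2 - x) / 3)) * (n:ℝ) ^ (2 * ((x + 1) / 3))) * 6 ^ ((x + 1) / 3) := by
        rw [Real.mul_rpow hf.le (by positivity), Real.mul_rpow hf.le (by positivity),
          Real.mul_rpow (by norm_num) (by positivity), Real.inv_rpow hn0.le,
          Real.rpow_neg hn0.le, ← Real.rpow_natCast (n:ℝ) 2, ← Real.rpow_mul hn0.le]
        push_cast
        ring
    _ = n.factorial * (n:ℝ) ^ x * 6 ^ ((x + 1) / 3) := by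
        rw [← Real.rpow_add hf, ← Real.rpow_add hn0, show (2 - x) / 3 + (x + 1) / 3 = 1 by ring,
          Real.rpow_one]
        ring_nf
    _ ≤ n.factorial * (n:ℝ) ^ x * 6 := by gcongr
    _ = _ := by ring

theorem Complex.tendsto_Gamma_add_nat_div {s : ℂ} (hs : ∀ m : ℕ, s ≠ -m) :
    Tendsto (fun n : ℕ => Complex.Gamma (s + n + 1) / ((n : ℂ) ^ s * n.factorial)) atTop
      (nhds 1) := by
  have h := (Complex.GammaSeq_tendsto_Gamma s).inv₀ (Complex.Gamma_ne_zero hs)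
  have h2 := h.const_mul (Complex.Gamma s)
  rw [mul_inv_cancel₀ (Complex.Gamma_ne_zero hs)] at h2
  refine h2.congr fun n => ?_
  have h3 : ∀ m : ℕ, Complex.Gamma (s + m) = (∏ j ∈ Finset.range m, (s + j)) * Complex.Gamma s := by
    intro m
    induction m with
    | zero => simp
    | succ m ih =>
      rw [Finset.prod_range_succ, Nat.cast_succ, ← add_assoc, Complex.Gamma_add_one, ih]
      · ring
      · intro h; exact hs m (by linear_combination h)
  have := h3 (n + 1)
  push_cast at this
  rw [← add_assoc] at this
  rw [this, Complex.GammaSeq, inv_div]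
  ring

theorem Complex.tendsto_digamma_add_nat_sub_log {z : ℂ} (h0 : 0 ≤ z.re) (h1 : z.re ≤ 1)
    (hz : 1 ≤ z.im) :
    Tendsto (fun n : ℕ => Complex.digamma (z + n + 1) - Complex.log n) atTop (nhds 0) := by
  set f : ℕ → ℂ → ℂ := fun n s => Complex.Gamma (s + n + 1) / ((n : ℂ) ^ s * n.factorial) with hf
  have hre : ∀ w ∈ Metric.closedBall z (1 / 2), -1 < w.re ∧ w.re < 2 ∧ 0 < w.im := by
    intro w hw
    rw [mem_closedBall_iff_norm] at hw
    have a1 := (Complex.abs_re_le_norm _).trans hw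
    have a2 := (Complex.abs_im_le_norm _).trans hw
    rw [Complex.sub_re, abs_le] at a1
    rw [Complex.sub_im, abs_le] at a2
    refine ⟨?_, ?_, ?_⟩ <;> linarith
  have hnat : ∀ w : ℂ, 0 < w.im → ∀ m : ℕ, w ≠ -m := by
    rintro w hw m rfl
    simp at hw
  have hder : ∀ n : ℕ, 1 ≤ n → ∀ w : ℂ, 0 < w.im →
      HasDerivAt (f n) (f n w * (Complex.digamma (w + n + 1) - Complex.log n)) w := by
    intro n hn w hw
    have hn0 : (n : ℂ) ≠ 0 := by exact_mod_cast (by omega : n ≠ 0)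
    have hw' : ∀ m : ℕ, w + n + 1 ≠ -m := hnat _ (by simpa using hw)
    have g1 := (Complex.differentiableAt_Gamma _ hw').hasDerivAt
    have g1' : HasDerivAt (fun s : ℂ => Complex.Gamma (s + n + 1))
        (deriv Complex.Gamma (w + n + 1)) w := by
      have := HasDerivAt.comp w g1 (((hasDerivAt_id w).add_const (n : ℂ)).add_const 1)
      simpa using! this
    have g2 : HasDerivAt (fun s : ℂ => (n : ℂ) ^ s) ((n : ℂ) ^ w * Complex.log n) w := by
      simpa using (hasDerivAt_id w).const_cpow (Or.inl hn0)
    have hne : (n : ℂ) ^ w ≠ 0 := by simp [Complex.cpow_eq_zero_iff, hn0]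
    have hfac : (n.factorial : ℂ) ≠ 0 := by exact_mod_cast n.factorial_ne_zero
    have hG := Complex.Gamma_ne_zero hw'
    refine (g1'.fun_div (g2.mul_const (n.factorial : ℂ)) (mul_ne_zero hne hfac)).congr_deriv ?_
    simp only [hf, Complex.digamma_def, logDeriv_apply]
    field_simp
  have hlim : ∀ w : ℂ, 0 < w.im → Tendsto (fun n => f n w) atTop (nhds 1) := fun w hw =>
    Complex.tendsto_Gamma_add_nat_div (hnat w hw)
  have hbound : ∀ n : ℕ, 1 ≤ n → ∀ w ∈ Metric.closedBall z (1 / 2), ‖f n w‖ ≤ 6 := by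
    intro n hn w hw
    obtain ⟨w1, w2, w3⟩ := hre w hw
    have hn0 : 0 < (n : ℝ) := by exact_mod_cast hn
    have hn1 : 1 ≤ (n : ℝ) := by exact_mod_cast hn
    have hfac : (0 : ℝ) < n.factorial := by exact_mod_cast n.factorial_pos
    simp only [hf, norm_div, norm_mul, Complex.norm_natCast]
    rw [Complex.norm_natCast_cpow_of_pos (by omega), div_le_iff₀ (by positivity)]
    refine (Complex.norm_Gamma_le_Gamma_re (by simp; linarith)).trans ?_
    simpa [mul_assoc] using Real.Gamma_add_nat_add_one_le w1 w2 hn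
  have hcauchy : ∀ n : ℕ, 1 ≤ n → ∮ w in C(z, 1 / 2), (1 / (w - z) ^ 2) • f n w
      = (2 * π * Complex.I) • deriv (f n) z := fun n hn =>
    DifferentiableOn.deriv_eq_smul_circleIntegral (by norm_num) fun w hw =>
      (hder n hn w (hre w hw).2.2).differentiableAt.differentiableWithinAt
  have hcauchy1 : ∮ w in C(z, 1 / 2), (1 / (w - z) ^ 2) • (1 : ℂ) = 0 := by
    rw [DifferentiableOn.deriv_eq_smul_circleIntegral (f := fun _ => (1 : ℂ)) (by norm_num)
      (differentiableOn_const _)]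
    simp
  have hsph : ∀ θ : ℝ, circleMap z (1 / 2) θ ∈ Metric.closedBall z (1 / 2) := fun θ =>
    circleMap_mem_closedBall _ (by norm_num) θ
  have hconv : Tendsto (fun n : ℕ => ∮ w in C(z, 1 / 2), (1 / (w - z) ^ 2) • f n w) atTop
      (nhds (∮ w in C(z, 1 / 2), (1 / (w - z) ^ 2) • (1 : ℂ))) := by
    unfold circleIntegral
    refine intervalIntegral.tendsto_integral_filter_of_dominated_convergence (fun _ => 12)
      ?_ ?_ (by simp) ?_
    · filter_upwards [eventually_ge_atTop 1] with n hn
      refine Continuous.aestronglyMeasurable ?_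
      have hc : Continuous fun θ => f n (circleMap z (1 / 2) θ) := by
        rw [continuous_iff_continuousAt]
        intro θ
        exact ContinuousAt.comp (f := circleMap z (1 / 2)) (g := f n)
          (hder n hn _ (hre _ (hsph θ)).2.2).continuousAt
          (continuous_circleMap z (1 / 2)).continuousAt
      have hc2 : Continuous fun θ => 1 / (circleMap z (1 / 2) θ - z) ^ 2 := by
        refine continuous_const.div (by fun_prop) fun θ => ?_
        simp [circleMap]
      simp only [deriv_circleMap]
      exact ((continuous_circleMap 0 (1 / 2)).mul_const _).smul (hc2.smul hc)
    · filter_upwards [eventually_ge_atTop 1] with n hn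
      refine Eventually.of_forall fun θ _ => ?_
      have := hbound n hn _ (hsph θ)
      simp [circleMap] at this ⊢
      linarith
    · refine Eventually.of_forall fun θ _ => ?_
      exact ((hlim _ (hre _ (hsph θ)).2.2).const_smul _).const_smul _
  rw [hcauchy1] at hconv
  have hz0 : 0 < z.im := by linarith
  have h2 : Tendsto (fun n : ℕ => (2 * π * Complex.I)⁻¹ *
      ((2 * π * Complex.I) • deriv (f n) z)) atTop (nhds 0) := by
    have := (hconv.const_mul (2 * π * Complex.I)⁻¹)
    rw [mul_zero] at this
    refine this.congr' ?_
    filter_upwards [eventually_ge_atTop 1] with n hn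
    rw [hcauchy n hn]
  have h3 := h2.div (hlim z hz0) one_ne_zero
  rw [zero_div] at h3
  refine h3.congr' ?_
  filter_upwards [eventually_ge_atTop 1, (hlim z hz0).eventually_ne one_ne_zero] with n hn hne
  have hd := (hder n hn z hz0).deriv
  have : (π : ℂ) ≠ 0 := by exact_mod_cast Real.pi_ne_zero
  simp only [Pi.div_apply, smul_eq_mul, hd]
  field_simp

theorem Complex.log_add_one_of_im_pos {z : ℂ} (hz : 0 < z.im) :
    Complex.log (z + 1) = Complex.log z + Complex.log (1 + 1 / z) := by
  have hz0 : z ≠ 0 := by rintro rfl; simp at hz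
  have h2 : (1 + 1 / z).im < 0 := by
    simp only [Complex.add_im, Complex.one_im, one_div, Complex.inv_im, zero_add]
    exact div_neg_of_neg_of_pos (by linarith) (Complex.normSq_pos.mpr hz0)
  have hz1 : 1 + 1 / z ≠ 0 := by intro h; rw [h] at h2; simp at h2
  rw [← (Complex.log_mul_eq_add_log_iff hz0 hz1).mpr]
  · congr 1; field_simp
  · have a1 := Complex.arg_nonneg_iff.mpr hz.le
    have a2 := Complex.arg_le_pi z
    have a3 := Complex.arg_neg_iff.mpr h2
    have a4 := Complex.neg_pi_lt_arg (1 + 1 / z)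
    constructor <;> linarith

theorem Complex.norm_half_inv_add_sub_log_le {z : ℂ} (hz : 2 ≤ ‖z‖) :
    ‖1 / (2 * z) + 1 / (2 * (z + 1)) - Complex.log (1 + 1 / z)‖ ≤ 2 / ‖z‖ ^ 3 := by
  have hz0 : z ≠ 0 := by rintro rfl; simp at hz; linarith
  have hzn : 0 < ‖z‖ := by linarith
  set w := 1 / z with hw
  have hwn : ‖w‖ = 1 / ‖z‖ := by simp [hw]
  have hw2 : ‖w‖ ≤ 1 / 2 := by
    rw [hwn]; exact one_div_le_one_div_of_le (by norm_num) hz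
  have h1w : 1 / 2 ≤ ‖1 + w‖ := by
    have := norm_sub_norm_le (1 : ℂ) (-w)
    rw [norm_neg, sub_neg_eq_add, norm_one] at this
    linarith
  have h1w0 : 1 + w ≠ 0 := by intro h; rw [h] at h1w; norm_num at h1w
  have hz10 : z + 1 ≠ 0 := by
    intro h; apply h1w0; rw [hw]; field_simp; simpa using h
  have hlog := Complex.norm_log_sub_logTaylor_le 2 (z := w) (by linarith)
  have hT : Complex.logTaylor (2 + 1) w = w - w ^ 2 / 2 := by
    simp [Complex.logTaylor, Finset.sum_range_succ]; ring
  rw [hT] at hlog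
  have hid : 1 / (2 * z) + 1 / (2 * (z + 1)) - Complex.log (1 + w) =
      w ^ 3 / (2 * (1 + w)) - (Complex.log (1 + w) - (w - w ^ 2 / 2)) := by
    have e1 : 1 / (2 * z) = w / 2 := by rw [hw]; field_simp
    have e2 : 1 / (2 * (z + 1)) = w / (2 * (1 + w)) := by
      rw [hw] at h1w0 ⊢; field_simp
    rw [e1, e2]; field_simp; ring
  rw [hid]
  have hinv : (1 - ‖w‖)⁻¹ ≤ 2 := by
    rw [inv_le_comm₀ (by linarith) (by norm_num)]; linarith
  have h3 : (0:ℝ) ≤ ‖w‖ ^ 3 := by positivity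
  calc _ ≤ ‖w ^ 3 / (2 * (1 + w))‖ + ‖Complex.log (1 + w) - (w - w ^ 2 / 2)‖ := norm_sub_le _ _
    _ ≤ ‖w‖ ^ 3 + ‖w‖ ^ 3 * 2 / 3 := by
        gcongr
        · rw [norm_div, norm_pow, norm_mul]
          apply div_le_self h3
          simp; linarith
        · refine hlog.trans ?_
          norm_num
          gcongr
    _ ≤ 2 * ‖w‖ ^ 3 := by linarith
    _ = 2 / ‖z‖ ^ 3 := by rw [hwn]; field_simp

theorem sum_inv_sq_add_sq_le (x : ℝ) {y : ℝ} (hy : 2 ≤ y) (n : ℕ) :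
    ∑ k ∈ Finset.range n, 1 / ((x + k) ^ 2 + y ^ 2) ≤ 2 * π / y := by
  have hy0 : 0 < y := by linarith
  have hstep : ∀ k : ℕ, 1 / ((x + k) ^ 2 + y ^ 2) ≤
      2 / y * (Real.arctan ((x + (k + 1 : ℕ)) / y) - Real.arctan ((x + k) / y)) := by
    intro k
    have hlt : x + (k:ℝ) < x + (k + 1 : ℕ) := by push_cast; linarith
    obtain ⟨c, hc, hceq⟩ := exists_hasDerivAt_eq_slope (fun u => Real.arctan (u / y))
      (fun u => 1 / (1 + (u / y) ^ 2) * (1 / y)) hlt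
      (by fun_prop) (fun u _ => ((hasDerivAt_id' u).div_const y).arctan)
    have e : x + ((k + 1 : ℕ) : ℝ) - (x + k) = 1 := by push_cast; ring
    rw [e, div_one] at hceq
    rw [← hceq]
    obtain ⟨c1, c2⟩ := hc
    push_cast at c2
    have : 2 / y * (1 / (1 + (c / y) ^ 2) * (1 / y)) = 2 / (y ^ 2 + c ^ 2) := by field_simp
    rw [this, div_le_div_iff₀ (by positivity) (by positivity)]
    have h1 : c ^ 2 ≤ 2 * (x + k) ^ 2 + 2 := by
      set d := c - (x + k)
      have hd : c = x + k + d := by ring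
      rw [hd]
      have d0 : 0 ≤ d := by simp only [d]; linarith
      have d1 : d ≤ 1 := by simp only [d]; linarith
      nlinarith [sq_nonneg (x + k - d)]
    nlinarith
  calc _ ≤ ∑ k ∈ Finset.range n, 2 / y * (Real.arctan ((x + (k + 1 : ℕ)) / y) -
        Real.arctan ((x + k) / y)) := Finset.sum_le_sum fun k _ => hstep k
    _ = 2 / y * (Real.arctan ((x + n) / y) - Real.arctan ((x + (0 : ℕ)) / y)) := by
        rw [← Finset.mul_sum,
          Finset.sum_range_sub (fun k : ℕ => Real.arctan ((x + k) / y))]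
    _ ≤ 2 / y * π := by
        gcongr
        have := Real.arctan_lt_pi_div_two ((x + n) / y)
        have := Real.neg_pi_div_two_lt_arctan ((x + (0 : ℕ)) / y)
        linarith
    _ = _ := by ring

theorem Complex.tendsto_digamma_sub_log {z : ℂ} (hz : 1 ≤ z.im) :
    Tendsto (fun n : ℕ => Complex.digamma (z + n) - Complex.log (z + n) + 1 / (2 * (z + n)))
      atTop (nhds 0) := by
  set D : ℂ → ℂ := fun z => Complex.digamma z - Complex.log z + 1 / (2 * z) with hD
  have base : ∀ z : ℂ, 0 ≤ z.re → z.re ≤ 1 → 1 ≤ z.im →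
      Tendsto (fun n : ℕ => D (z + n)) atTop (nhds 0) := by
    intro z h0 h1 hz
    rw [← tendsto_add_atTop_iff_nat 1]
    have hn : Tendsto (fun n : ℕ => (n : ℂ)⁻¹) atTop (nhds 0) := by
      exact tendsto_inv_atTop_nhds_zero_nat (𝕜 := ℂ)
    have e1 := Complex.tendsto_digamma_add_nat_sub_log h0 h1 hz
    have e2 : Tendsto (fun n : ℕ => Complex.log (1 + (z + 1) * (n : ℂ)⁻¹)) atTop (nhds 0) := by
      have : Tendsto (fun n : ℕ => 1 + (z + 1) * (n : ℂ)⁻¹) atTop (nhds 1) := by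
        simpa using (hn.const_mul (z + 1)).const_add 1
      have := this.clog (by simp)
      simpa using this
    have e3 : Tendsto (fun n : ℕ => (n : ℂ)⁻¹ * (2 * (1 + (z + 1) * (n : ℂ)⁻¹))⁻¹)
        atTop (nhds 0) := by
      have : Tendsto (fun n : ℕ => 2 * (1 + (z + 1) * (n : ℂ)⁻¹)) atTop (nhds 2) := by
        simpa using ((hn.const_mul (z + 1)).const_add 1).const_mul 2
      simpa using hn.mul (this.inv₀ (by norm_num))
    have e4 := (e1.sub e2).add e3
    simp only [sub_zero, add_zero] at e4
    refine e4.congr' ?_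
    filter_upwards [eventually_ge_atTop 1] with n hn
    have hn0 : (n : ℂ) ≠ 0 := by exact_mod_cast (by omega : n ≠ 0)
    have hne : z + n + 1 ≠ 0 := by
      intro h
      have := congrArg Complex.im h
      simp at this; linarith
    have e5 : z + n + 1 = ((n : ℝ) : ℂ) * (1 + (z + 1) * (n : ℂ)⁻¹) := by
      push_cast; field_simp; ring
    have hne2 : 1 + (z + 1) * (n : ℂ)⁻¹ ≠ 0 := by
      intro h; rw [h, mul_zero] at e5; exact hne e5
    simp only [hD]
    push_cast
    rw [← add_assoc]
    have e6 : Complex.log (z + n + 1) = Complex.log n + Complex.log (1 + (z + 1) * (n : ℂ)⁻¹) := by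
      rw [e5, Complex.log_ofReal_mul (by exact_mod_cast hn) hne2,
        Complex.ofReal_log (by positivity)]
      simp
    have e7 : 1 / (2 * (z + n + 1)) = (n : ℂ)⁻¹ * (2 * (1 + (z + 1) * (n : ℂ)⁻¹))⁻¹ := by
      rw [e5]; push_cast; rw [one_div, ← mul_inv]; ring
    rw [e6, e7]; ring
  have shift : ∀ z : ℂ, Tendsto (fun n : ℕ => D (z + 1 + n)) atTop (nhds 0) ↔
      Tendsto (fun n : ℕ => D (z + n)) atTop (nhds 0) := by
    intro z
    rw [← tendsto_add_atTop_iff_nat (f := fun n : ℕ => D (z + n)) 1]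
    refine tendsto_congr fun n => ?_
    push_cast; congr 1; ring
  have hall : ∀ m : ℤ, ∀ z : ℂ, 0 ≤ z.re → z.re ≤ 1 → 1 ≤ z.im →
      Tendsto (fun n : ℕ => D (z + m + n)) atTop (nhds 0) := by
    intro m z h0 h1 h2
    induction m using Int.induction_on with
    | zero => simpa using base z h0 h1 h2
    | succ i ih =>
      have := (shift _).mpr ih
      push_cast at this ⊢
      simpa only [add_assoc] using this
    | pred i ih =>
      refine (shift _).mp ?_
      rw [show z + ((-(i : ℤ) - 1 : ℤ) : ℂ) + 1 = z + ((-(i : ℤ) : ℤ) : ℂ) by push_cast; ring]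
      exact ih
  have := hall ⌊z.re⌋ (z - ⌊z.re⌋) (by simp) (by
    simpa using (Int.fract_lt_one z.re).le) (by simpa using hz)
  rw [sub_add_cancel] at this
  exact this

theorem Complex.norm_digamma_sub_log_le {z : ℂ} (hz : 2 ≤ z.im) :
    ‖Complex.digamma z - Complex.log z + 1 / (2 * z)‖ ≤ 4 * π / z.im ^ 2 := by
  set D : ℂ → ℂ := fun z => Complex.digamma z - Complex.log z + 1 / (2 * z) with hD
  have hy0 : 0 < z.im := by linarith
  have step : ∀ n : ℕ, ‖D (z + n) - D (z + (n + 1 : ℕ))‖ ≤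
      2 / z.im * (1 / ((z.re + n) ^ 2 + z.im ^ 2)) := by
    intro n
    have him : (z + n).im = z.im := by simp
    have hnorm : ‖z + n‖ ^ 2 = (z.re + n) ^ 2 + z.im ^ 2 := by
      rw [Complex.sq_norm, Complex.normSq_apply]; simp; ring
    have hge : z.im ≤ ‖z + n‖ := by
      rw [← him]; exact Complex.im_le_norm _
    have hfe := Complex.digamma_apply_add_one (z + n) (by
      intro m h; have := congrArg Complex.im h; simp at this; linarith)
    have hlog := Complex.log_add_one_of_im_pos (z := z + n) (by rw [him]; exact hy0)
    have hne : z + n ≠ 0 := by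
      intro h; rw [h] at him; simp at him; linarith
    have hb := Complex.norm_half_inv_add_sub_log_le (z := z + n) (hz.trans hge)
    have : D (z + n) - D (z + (n + 1 : ℕ)) = -(1 / (2 * (z + n)) + 1 / (2 * (z + n + 1)) -
        Complex.log (1 + 1 / (z + n))) := by
      simp only [hD]
      push_cast
      rw [← add_assoc, hfe, hlog]
      field_simp
      ring
    rw [this, norm_neg]
    refine hb.trans ?_
    rw [← hnorm, div_mul_div_comm, mul_one]
    apply div_le_div_of_nonneg_left (by norm_num) (by positivity)
    rw [pow_succ' _ 2]
    gcongr
  have hlim : Tendsto (fun n : ℕ => D (z + (0 : ℕ)) - D (z + n)) atTop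
      (nhds (D (z + (0 : ℕ)) - 0)) :=
    (Complex.tendsto_digamma_sub_log (by linarith)).const_sub _
  have hle : ‖D (z + (0 : ℕ)) - 0‖ ≤ 4 * π / z.im ^ 2 := by
    refine le_of_tendsto hlim.norm (Eventually.of_forall fun n => ?_)
    rw [← Finset.sum_range_sub' (fun n : ℕ => D (z + n))]
    calc _ ≤ ∑ k ∈ Finset.range n, 2 / z.im * (1 / ((z.re + k) ^ 2 + z.im ^ 2)) :=
          (norm_sum_le _ _).trans (Finset.sum_le_sum fun k _ => step k)
      _ ≤ 2 / z.im * (2 * π / z.im) := by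
          rw [← Finset.mul_sum]
          gcongr
          exact sum_inv_sq_add_sq_le _ hz n
      _ = _ := by ring
  rwa [sub_zero, Nat.cast_zero, add_zero] at hle

/-- A nonvanishing function whose logarithmic derivative is `O(t⁻²)` at infinity. -/
def IsSlow (g : ℝ → ℂ) : Prop :=
  ∃ (C : ℝ) (r : ℝ → ℂ), ∀ᶠ t in atTop, g t ≠ 0 ∧ HasDerivAt g (g t * r t) t ∧ ‖r t‖ ≤ C / t ^ 2

namespace IsSlow

theorem mul {f g : ℝ → ℂ} (hf : IsSlow f) (hg : IsSlow g) : IsSlow fun t => f t * g t := by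
  obtain ⟨C, r, h1⟩ := hf
  obtain ⟨D, s, h2⟩ := hg
  refine ⟨C + D, fun t => r t + s t, ?_⟩
  filter_upwards [h1, h2] with t ⟨a1, a2, a3⟩ ⟨b1, b2, b3⟩
  refine ⟨mul_ne_zero a1 b1, (a2.fun_mul b2).congr_deriv (by ring), ?_⟩
  rw [add_div]
  exact (norm_add_le _ _).trans (add_le_add a3 b3)

theorem inv {f : ℝ → ℂ} (hf : IsSlow f) : IsSlow fun t => (f t)⁻¹ := by
  obtain ⟨C, r, h1⟩ := hf
  refine ⟨C, fun t => -r t, ?_⟩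
  filter_upwards [h1] with t ⟨a1, a2, a3⟩
  refine ⟨inv_ne_zero a1, (a2.fun_inv a1).congr_deriv ?_, by rwa [norm_neg]⟩
  field_simp

theorem conj {f : ℝ → ℂ} (hf : IsSlow f) : IsSlow fun t => (starRingEnd ℂ) (f t) := by
  obtain ⟨C, r, h1⟩ := hf
  refine ⟨C, fun t => (starRingEnd ℂ) (r t), ?_⟩
  filter_upwards [h1] with t ⟨a1, a2, a3⟩
  refine ⟨by simpa using a1, ?_, by simpa using a3⟩
  rw [← map_mul]
  exact a2.star

theorem exists_bound {f : ℝ → ℂ} (hf : IsSlow f) : ∃ C, ∀ᶠ t in atTop, ‖f t‖ ≤ C := by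
  obtain ⟨C, r, h1⟩ := hf
  obtain ⟨T, hT⟩ := eventually_atTop.mp (h1.and (eventually_ge_atTop (1 : ℝ)))
  have hT1 := (hT T le_rfl).2
  have hC : 0 ≤ C := by
    have h := (norm_nonneg _).trans (hT T le_rfl).1.2.2
    have : 0 < T ^ 2 := by positivity
    by_contra! hneg
    exact absurd h (not_le.mpr (div_neg_of_neg_of_pos hneg this))
  set F : ℝ → ℝ := fun t => ‖f t‖ ^ 2 * Real.exp (2 * C * t⁻¹) with hF
  have hd : ∀ t, T ≤ t → HasDerivAt F
      (2 * ‖f t‖ ^ 2 * ((r t).re - C / t ^ 2) * Real.exp (2 * C * t⁻¹)) t := by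
    intro t ht
    obtain ⟨⟨a1, a2, a3⟩, a4⟩ := hT t ht
    have b1 := a2.norm_sq
    have b2 := (((hasDerivAt_inv (by linarith : t ≠ 0)).const_mul (2 * C))).exp
    refine (b1.mul b2).congr_deriv ?_
    have : inner ℝ (f t) (f t * r t) = ‖f t‖ ^ 2 * (r t).re := by
      rw [Complex.inner, Complex.sq_norm, Complex.normSq_apply]
      simp
      ring
    rw [this]
    field_simp
    ring
  have hanti : AntitoneOn F (Set.Ici T) := by
    refine antitoneOn_of_deriv_nonpos (convex_Ici T)
      (fun t ht => (hd t ht).continuousAt.continuousWithinAt)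
      (fun t ht => (hd t (interior_subset ht)).differentiableAt.differentiableWithinAt)
      fun t ht => ?_
    have ht' : T ≤ t := interior_subset ht
    rw [(hd t ht').deriv]
    have := (Complex.re_le_norm (r t)).trans (hT t ht').1.2.2
    apply mul_nonpos_of_nonpos_of_nonneg _ (Real.exp_pos _).le
    apply mul_nonpos_of_nonneg_of_nonpos (by positivity)
    linarith
  refine ⟨Real.sqrt (F T), ?_⟩
  filter_upwards [eventually_ge_atTop T] with t ht
  apply Real.le_sqrt_of_sq_le
  refine le_trans ?_ (hanti (Set.mem_Ici.mpr le_rfl) ht ht)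
  have : 1 ≤ Real.exp (2 * C * t⁻¹) := Real.one_le_exp (by
    have : 0 < t := by linarith
    positivity)
  simp only [hF]
  nlinarith [sq_nonneg ‖f t‖]

end IsSlow

theorem isSlow_Gamma (a : ℝ) : IsSlow fun t : ℝ =>
    Complex.Gamma (a + t * Complex.I) * ((t ^ (1 / 2 - a) : ℝ) : ℂ) *
      ((Real.exp (π / 2 * t) : ℝ) : ℂ)
      * Complex.exp (-Complex.I * ((t * Real.log t - t : ℝ) : ℂ)) := by
  refine ⟨4 * π + a ^ 2 + |a|, fun t => Complex.I * Complex.digamma (a + t * Complex.I) +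
    (1 / 2 - a) / t + π / 2 - Complex.I * (Real.log t : ℝ), ?_⟩
  filter_upwards [eventually_ge_atTop 2, eventually_ge_atTop (2 * |a|)] with t ht hta
  have ht0 : 0 < t := by linarith
  have htc : (t : ℂ) ≠ 0 := by exact_mod_cast ht0.ne'
  set z : ℂ := a + t * Complex.I with hz
  have him : z.im = t := by simp [hz]
  have hzm : ∀ m : ℕ, z ≠ -m := by
    intro m h
    have := congrArg Complex.im h
    simp [him] at this; linarith
  have hz0 : z ≠ 0 := by simpa using hzm 0
  refine ⟨?_, ?_, ?_⟩
  · have : t ^ (1 / 2 - a) ≠ 0 := (Real.rpow_pos_of_pos ht0 _).ne'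
    refine mul_ne_zero (mul_ne_zero (mul_ne_zero (Complex.Gamma_ne_zero hzm) ?_) ?_)
      (Complex.exp_ne_zero _)
    · exact_mod_cast this
    · exact_mod_cast (Real.exp_pos _).ne'
  · have g1 : HasDerivAt (fun t : ℝ => Complex.Gamma (a + t * Complex.I))
        (Complex.Gamma z * (Complex.digamma z * Complex.I)) t := by
      have h1 := (Complex.differentiableAt_Gamma _ hzm).hasDerivAt
      have h2 : HasDerivAt (fun t : ℝ => (a : ℂ) + t * Complex.I) Complex.I t := by
        simpa using ((hasDerivAt_id' t).ofReal_comp.mul_const Complex.I).const_add (a : ℂ)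
      refine (HasDerivAt.comp t h1 h2).congr_deriv ?_
      rw [Complex.digamma_def, logDeriv_apply]
      have := Complex.Gamma_ne_zero hzm
      field_simp
    have g2 := (Real.hasDerivAt_rpow_const (x := t) (p := 1 / 2 - a) (Or.inl ht0.ne')).ofReal_comp
    have g3 := (((hasDerivAt_id' t).const_mul (π / 2)).exp).ofReal_comp
    have g4 := ((((hasDerivAt_id' t).fun_mul (Real.hasDerivAt_log ht0.ne')).fun_sub
      (hasDerivAt_id' t)).ofReal_comp.const_mul (-Complex.I)).cexp
    refine (((g1.fun_mul g2).fun_mul g3).fun_mul g4).congr_deriv ?_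
    rw [Real.rpow_sub_one ht0.ne', ← hz]
    push_cast
    field_simp
    ring
  · have hD := Complex.norm_digamma_sub_log_le (z := z) (by rw [him]; exact ht)
    rw [him] at hD
    set D := Complex.digamma z - Complex.log z + 1 / (2 * z) with hDdef
    set w : ℂ := -(Complex.I * (a / t)) with hw
    have hwn : ‖w‖ = |a| / t := by
      simp [hw, abs_of_pos ht0]
    have hwle : ‖w‖ ≤ 1 / 2 := by
      rw [hwn, div_le_iff₀ ht0]; linarith
    have hL := Complex.norm_log_one_add_sub_self_le (z := w) (by linarith)
    have h1w : 1 + w ≠ 0 := by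
      intro h
      have : ‖w‖ = 1 := by rw [show w = -1 by linear_combination h]; simp
      linarith
    have hzw : z = (t : ℂ) * (Complex.I * (1 + w)) := by
      have : Complex.I * Complex.I = -1 := Complex.I_mul_I
      rw [hz, hw]; field_simp; linear_combination (a : ℂ) * this
    have hlogI : Complex.log (Complex.I * (1 + w)) =
        Complex.log Complex.I + Complex.log (1 + w) := by
      refine (Complex.log_mul_eq_add_log_iff Complex.I_ne_zero h1w).mpr ?_
      have hre : 0 < (1 + w).re := by simp [hw]
      have := abs_lt.mp (Complex.abs_arg_lt_pi_div_two_iff.mpr (Or.inl hre))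
      rw [Complex.arg_I]
      constructor <;> linarith
    have hlog : Complex.log z = Real.log t + (π / 2 * Complex.I + Complex.log (1 + w)) := by
      rw [hzw, Complex.log_ofReal_mul ht0 (mul_ne_zero Complex.I_ne_zero h1w), hlogI,
        Complex.log_I]
    have hr : Complex.I * Complex.digamma z + (1 / 2 - a) / t + π / 2 - Complex.I * (Real.log t : ℝ)
        = Complex.I * D + Complex.I * (Complex.log (1 + w) - w) + a / (2 * t * z) := by
      have e1 : Complex.digamma z = D + Complex.log z - 1 / (2 * z) := by rw [hDdef]; ring
      have hI : Complex.I * Complex.I = -1 := Complex.I_mul_I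
      have e2 : (a : ℂ) / (2 * t * z) = 1 / (2 * t) - Complex.I / (2 * z) := by
        rw [hz] at hz0 ⊢
        field_simp; ring
      have e3 : Complex.I * w = a / t := by rw [hw]; linear_combination (-(a : ℂ) / t) * hI
      rw [e1, hlog, e2]
      linear_combination (π / 2 : ℂ) * hI + e3
    rw [hr]
    have hzt : t ≤ ‖z‖ := by rw [← him]; exact Complex.im_le_norm z
    have t1 : ‖Complex.I * D‖ ≤ 4 * π / t ^ 2 := by simpa using hD
    have t2 : ‖Complex.I * (Complex.log (1 + w) - w)‖ ≤ a ^ 2 / t ^ 2 := by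
      rw [norm_mul, Complex.norm_I, one_mul]
      refine hL.trans ?_
      have hinv : (1 - ‖w‖)⁻¹ ≤ 2 := by
        rw [inv_le_comm₀ (by linarith) (by norm_num)]; linarith
      calc _ ≤ ‖w‖ ^ 2 * 2 / 2 := by gcongr
        _ = a ^ 2 / t ^ 2 := by rw [hwn, div_pow, sq_abs]; ring
    have t3 : ‖(a : ℂ) / (2 * t * z)‖ ≤ |a| / t ^ 2 := by
      rw [norm_div, norm_mul, norm_mul]
      simp only [Complex.norm_real, Real.norm_eq_abs, abs_of_pos ht0, Complex.norm_ofNat]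
      apply div_le_div_of_nonneg_left (abs_nonneg _) (by positivity)
      nlinarith
    calc _ ≤ 4 * π / t ^ 2 + a ^ 2 / t ^ 2 + |a| / t ^ 2 :=
          (norm_add₃_le).trans (add_le_add (add_le_add t1 t2) t3)
      _ = _ := by ring

theorem exists_norm_le_one_add_abs_rpow {g : ℝ → ℂ} (hg : Continuous g)
    (hneg : ∀ t, ‖g (-t)‖ = ‖g t‖) {C r : ℝ} (h : ∀ᶠ t in atTop, ‖g t‖ ≤ C * t ^ r) :
    ∃ C', ∀ t : ℝ, ‖g t‖ ≤ C' * (1 + |t|) ^ r := by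
  obtain ⟨T, hT⟩ := eventually_atTop.mp (h.and (eventually_ge_atTop (1 : ℝ)))
  have hT1 := (hT T le_rfl).2
  have hp : ∀ t : ℝ, 0 < (1 + |t|) ^ r := fun t => Real.rpow_pos_of_pos (by positivity) _
  have hcont : Continuous fun t : ℝ => ‖g t‖ / (1 + |t|) ^ r :=
    hg.norm.div ((by fun_prop : Continuous fun t : ℝ => 1 + |t|).rpow_const fun t =>
      Or.inl (by positivity)) fun t => (hp t).ne'
  obtain ⟨M, hM⟩ := (isCompact_Icc (a := (0 : ℝ)) (b := T)).exists_bound_of_continuousOn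
    hcont.continuousOn
  have hpos : ∀ t : ℝ, 0 ≤ t → ‖g t‖ ≤ max M (|C| * 2 ^ |r|) * (1 + |t|) ^ r := by
    intro t ht
    rw [← div_le_iff₀ (hp t)]
    rcases le_total t T with h1 | h1
    · exact ((le_abs_self _).trans (hM t ⟨ht, h1⟩)).trans (le_max_left _ _)
    · obtain ⟨h2, h3⟩ := hT t h1
      have h0 : 0 < t := by linarith
      refine le_trans ?_ (le_max_right _ _)
      rw [div_le_iff₀ (hp t), abs_of_pos h0]
      refine h2.trans ?_
      have h4 : 1 ≤ (1 + t) / t := by rw [le_div_iff₀ h0]; linarith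
      have h5 : (1 + t) / t ≤ 2 := by rw [div_le_iff₀ h0]; linarith
      have h6 : t ^ r = ((1 + t) / t) ^ (-r) * (1 + t) ^ r := by
        rw [Real.rpow_neg (by positivity), Real.div_rpow (by positivity) h0.le]
        have := (Real.rpow_pos_of_pos (by linarith : 0 < 1 + t) r).ne'
        field_simp
      rw [h6, ← mul_assoc]
      gcongr
      · exact le_abs_self C
      · exact (Real.rpow_le_rpow_of_exponent_le h4 (neg_le_abs r)).trans
          (Real.rpow_le_rpow (by positivity) h5 (abs_nonneg r))
  refine ⟨max M (|C| * 2 ^ |r|), fun t => ?_⟩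
  rcases le_total 0 t with h0 | h0
  · exact hpos t h0
  · have := hpos (-t) (by linarith)
    rwa [hneg, abs_neg] at this

theorem exists_norm_Gamma_div_Gamma_le (a b : ℝ) : ∃ C, ∀ᶠ t : ℝ in atTop,
    ‖Complex.Gamma (a + t * Complex.I) * (Complex.Gamma (b + t * Complex.I))⁻¹‖ ≤
      C * t ^ (a - b) := by
  obtain ⟨C, hC⟩ := ((isSlow_Gamma a).mul (isSlow_Gamma b).inv).exists_bound
  refine ⟨C, ?_⟩
  filter_upwards [hC, eventually_gt_atTop 0] with t ht ht0
  have h1 : ∀ y : ℝ, ‖Complex.exp (-Complex.I * (y : ℂ))‖ = 1 := by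
    intro y
    rw [show -Complex.I * (y : ℂ) = ((-y : ℝ) : ℂ) * Complex.I by push_cast; ring,
      Complex.norm_exp_ofReal_mul_I]
  have e := Real.exp_pos (π / 2 * t)
  have p1 := Real.rpow_pos_of_pos ht0 (1 / 2 - a)
  have p2 := Real.rpow_pos_of_pos ht0 (1 / 2 - b)
  simp only [norm_mul, norm_inv, h1, Complex.norm_real, Real.norm_eq_abs, abs_of_pos e,
    abs_of_pos p1, abs_of_pos p2, mul_one] at ht ⊢
  have h3 : t ^ (a - b) = t ^ (1 / 2 - b) / t ^ (1 / 2 - a) := by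
    rw [← Real.rpow_sub ht0]; congr 1; ring
  rw [h3, mul_div_assoc', le_div_iff₀ p1, ← div_le_iff₀ p2]
  refine le_trans (le_of_eq ?_) ht
  field_simp

/-- The quotient of gamma factors `Γ(b - it)³ / (Γ(c + it)² Γ(d + it))`. -/
noncomputable def gammaKernel (b c d : ℝ) (t : ℝ) : ℂ :=
  Complex.Gamma (b - t * Complex.I) ^ 3 * ((Complex.Gamma (c + t * Complex.I))⁻¹ ^ 2 *
    (Complex.Gamma (d + t * Complex.I))⁻¹)

theorem gammaKernel_neg (b c d t : ℝ) :
    gammaKernel b c d (-t) = (starRingEnd ℂ) (gammaKernel b c d t) := by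
  simp only [gammaKernel, map_mul, map_pow, map_inv₀, ← Complex.Gamma_conj, map_add, map_sub,
    Complex.conj_ofReal, Complex.conj_I]
  simp only [Complex.ofReal_neg, neg_mul, mul_neg]

theorem continuous_gammaKernel {b : ℝ} (hb : 0 < b) (c d : ℝ) : Continuous (gammaKernel b c d) := by
  have h1 : Continuous fun t : ℝ => Complex.Gamma (b - t * Complex.I) := by
    rw [continuous_iff_continuousAt]
    intro t
    have : ContinuousAt Complex.Gamma (b - t * Complex.I) := by
      refine (Complex.differentiableAt_Gamma _ fun m h => ?_).continuousAt
      have := congrArg Complex.re h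
      simp at this
      have : (0:ℝ) ≤ m := by positivity
      linarith
    exact ContinuousAt.comp (f := fun t : ℝ => (b : ℂ) - t * Complex.I) this (by fun_prop)
  have h2 : ∀ e : ℝ, Continuous fun t : ℝ => (Complex.Gamma (e + t * Complex.I))⁻¹ := fun e =>
    Complex.differentiable_one_div_Gamma.continuous.comp
      (by fun_prop : Continuous fun t : ℝ => (e : ℂ) + t * Complex.I)
  exact (h1.pow 3).mul (((h2 c).pow 2).mul (h2 d))

theorem exists_isSlow_gammaKernel {b c d : ℝ} (h : 3 * b - 2 * c - d = -(1 / 2)) :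
    ∃ g : ℝ → ℂ, IsSlow g ∧ ∀ t : ℝ, 0 < t → gammaKernel b c d t =
      g t * (((t ^ (-(1 / 2) : ℝ) : ℝ) : ℂ) *
        Complex.exp (Complex.I * ((-6 * (t * Real.log t - t) : ℝ) : ℂ))) := by
  have s1 := (isSlow_Gamma b).conj
  have s2 := (isSlow_Gamma c).inv
  have s3 := (isSlow_Gamma d).inv
  refine ⟨_, (s1.mul (s1.mul s1)).mul ((s2.mul s2).mul s3), fun t ht => ?_⟩
  have hconj : (starRingEnd ℂ) (Complex.Gamma (b + t * Complex.I)) =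
      Complex.Gamma (b - t * Complex.I) := by
    rw [← Complex.Gamma_conj]
    simp [sub_eq_add_neg]
  simp only [map_mul, hconj, Complex.conj_ofReal, ← Complex.exp_conj, map_neg, Complex.conj_I,
    neg_neg, mul_inv, ← Complex.exp_neg, gammaKernel]
  set θ : ℝ := t * Real.log t - t
  have hexp : ((Complex.exp (Complex.I * θ)) * (Complex.exp (Complex.I * θ) *
      Complex.exp (Complex.I * θ)) *
      (Complex.exp (-(-Complex.I * θ)) * Complex.exp (-(-Complex.I * θ)) *
      Complex.exp (-(-Complex.I * θ)))) * Complex.exp (Complex.I * ((-6 * θ : ℝ) : ℂ)) = 1 := by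
    simp only [← Complex.exp_add]
    rw [← Complex.exp_zero]
    congr 1
    push_cast; ring
  have hreal : ((t ^ (1 / 2 - b)) * ((t ^ (1 / 2 - b)) * (t ^ (1 / 2 - b)))) *
      ((t ^ (1 / 2 - c))⁻¹ * (t ^ (1 / 2 - c))⁻¹ * (t ^ (1 / 2 - d))⁻¹) *
        t ^ (-(1 / 2) : ℝ) = 1 := by
    simp only [← Real.rpow_neg ht.le, ← Real.rpow_add ht]
    rw [show 1 / 2 - b + (1 / 2 - b + (1 / 2 - b)) + (-(1 / 2 - c) + -(1 / 2 - c) + -(1 / 2 - d)) +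
      -(1 / 2) = 0 by linarith, Real.rpow_zero]
  have hreal' := congrArg (fun x : ℝ => (x : ℂ)) hreal
  push_cast at hreal'
  have e0 : ((Real.exp (π / 2 * t) : ℝ) : ℂ) ≠ 0 := by exact_mod_cast (Real.exp_pos _).ne'
  set G := Complex.Gamma (b - t * Complex.I)
  set E := ((Real.exp (π / 2 * t) : ℝ) : ℂ)
  set A := (Complex.Gamma (c + t * Complex.I))⁻¹
  set B := (Complex.Gamma (d + t * Complex.I))⁻¹
  have hE : E ^ 3 * E⁻¹ ^ 3 = 1 := by rw [← mul_pow, mul_inv_cancel₀ e0, one_pow]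
  rw [← mul_one (G ^ 3 * (A ^ 2 * B)), ← hE, ← mul_one (G ^ 3 * (A ^ 2 * B) * _), ← hreal',
    ← mul_one (G ^ 3 * (A ^ 2 * B) * _ * _), ← hexp]
  ring

theorem exists_norm_gammaKernel_le {b c d : ℝ} (hb : 0 < b) (h : 3 * b - 2 * c - d = -(1 / 2)) :
    ∃ C, ∀ t : ℝ, ‖gammaKernel b c d t‖ ≤ C * (1 + |t|) ^ (-(1 / 2) : ℝ) := by
  obtain ⟨g, hg, hgK⟩ := exists_isSlow_gammaKernel h
  obtain ⟨C, hC⟩ := hg.exists_bound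
  refine exists_norm_le_one_add_abs_rpow (continuous_gammaKernel hb c d)
    (fun t => by rw [gammaKernel_neg]; simp) (C := C) ?_
  filter_upwards [hC, eventually_gt_atTop (0 : ℝ)] with t ht ht0
  rw [hgK t ht0, norm_mul, norm_mul, mul_comm Complex.I, Complex.norm_exp_ofReal_mul_I,
    mul_one, Complex.norm_real, Real.norm_eq_abs, abs_of_pos (Real.rpow_pos_of_pos ht0 _)]
  gcongr

theorem exists_norm_integral_gammaKernel_le {b c d : ℝ} (hb : 0 < b)
    (h : 3 * b - 2 * c - d = -(1 / 2)) :
    ∃ C, ∀ L T : ℝ, 0 ≤ T →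
      ‖∫ t in (-T)..T, gammaKernel b c d t * Complex.exp (Complex.I * ((L * t : ℝ) : ℂ))‖ ≤ C := by
  obtain ⟨g, hg, hgK⟩ := exists_isSlow_gammaKernel h
  obtain ⟨C₁, hC₁⟩ := hg.exists_bound
  obtain ⟨C₀, r, hr⟩ := hg
  obtain ⟨A, hA⟩ := eventually_atTop.mp ((hC₁.and hr).and (eventually_ge_atTop (1 : ℝ)))
  have hA1 := (hA A le_rfl).2
  have hC1 : 0 ≤ C₁ := (norm_nonneg _).trans (hA A le_rfl).1.1
  have hC0 : 0 ≤ C₀ := by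
    have h := (norm_nonneg _).trans (hA A le_rfl).1.2.2.2
    have : 0 < A ^ 2 := by positivity
    by_contra! hneg
    exact absurd h (not_le.mpr (div_neg_of_neg_of_pos hneg this))
  have hcont := continuous_gammaKernel hb c d
  have hcontL : ∀ L : ℝ, Continuous fun t : ℝ =>
      gammaKernel b c d t * Complex.exp (Complex.I * ((L * t : ℝ) : ℂ)) := fun L => by fun_prop
  have hnormL : ∀ L t : ℝ, ‖gammaKernel b c d t * Complex.exp (Complex.I * ((L * t : ℝ) : ℂ))‖ =
      ‖gammaKernel b c d t‖ := fun L t => by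
    rw [norm_mul, mul_comm Complex.I, Complex.norm_exp_ofReal_mul_I, mul_one]
  set M := ∫ t in (0 : ℝ)..A, ‖gammaKernel b c d t‖ with hM
  have hsmall : ∀ L T : ℝ, 0 ≤ T → T ≤ A →
      ‖∫ t in (0 : ℝ)..T, gammaKernel b c d t * Complex.exp (Complex.I * ((L * t : ℝ) : ℂ))‖ ≤
        M := by
    intro L T h0 h1
    refine (intervalIntegral.norm_integral_le_integral_norm h0).trans ?_
    simp only [hnormL]
    exact intervalIntegral.integral_mono_interval le_rfl h0 h1
      (Eventually.of_forall fun _ => norm_nonneg _) (hcont.norm.intervalIntegrable _ _)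
  have hlarge : ∀ L T : ℝ, A ≤ T →
      ‖∫ t in A..T, gammaKernel b c d t * Complex.exp (Complex.I * ((L * t : ℝ) : ℂ))‖ ≤
        10 * C₁ + 10 * C₁ * C₀ := by
    intro L T hT
    set k : ℝ → ℂ := fun u => ((u ^ (-(1 / 2) : ℝ) : ℝ) : ℂ) *
      Complex.exp (Complex.I * ((-6 * (u * Real.log u - u) + L * u : ℝ) : ℂ)) with hk
    have hkc : ∀ u, 0 < u → ContinuousAt k u := by
      intro u hu
      have : ContinuousAt (fun u : ℝ => u ^ (-(1 / 2) : ℝ)) u :=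
        Real.continuousAt_rpow_const _ _ (Or.inl hu.ne')
      have h2 : ContinuousAt Real.log u := Real.continuousAt_log hu.ne'
      have h3 : ContinuousAt (fun u : ℝ => -6 * (u * Real.log u - u) + L * u) u := by fun_prop
      exact (Complex.continuous_ofReal.continuousAt.comp this).mul
        ((continuousAt_const.mul (Complex.continuous_ofReal.continuousAt.comp h3)).cexp)
    have hkon : ∀ u, A ≤ u → ContinuousOn k (Set.uIcc A u) := fun u hu v hv => by
      rw [Set.uIcc_of_le hu] at hv
      exact (hkc v (by linarith [hv.1])).continuousWithinAt
    set J : ℝ → ℂ := fun u => ∫ v in A..u, k v with hJ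
    have hJd : ∀ u, A ≤ u → HasDerivAt J (k u) u := fun u hu => by
      refine intervalIntegral.integral_hasDerivAt_right (hkon u hu).intervalIntegrable ?_
        (hkc u (by linarith))
      refine ContinuousOn.stronglyMeasurableAtFilter (s := Set.Ioi 0) isOpen_Ioi
        (fun v hv => (hkc v hv).continuousWithinAt) u (by simp; linarith)
    have hJb : ∀ u, A ≤ u → ‖J u‖ ≤ 10 := fun u hu => norm_integral_rpow_mul_exp_le L hA1 hu
    have hgd : ∀ u, A ≤ u → HasDerivAt g (g u * r u) u := fun u hu => (hA u hu).1.2.2.1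
    have hgb : ∀ u, A ≤ u → ‖g u * r u‖ ≤ C₁ * (C₀ / u ^ 2) := fun u hu => by
      rw [norm_mul]
      have := (hA u hu).1
      exact mul_le_mul this.1 this.2.2.2 (norm_nonneg _) hC1
    have hgint : IntervalIntegrable (fun u => g u * r u) MeasureTheory.volume A T := by
      have h1 : IntervalIntegrable (deriv g) MeasureTheory.volume A T := by
        rw [intervalIntegrable_iff_integrableOn_Ioc_of_le hT]
        refine MeasureTheory.Measure.integrableOn_of_bounded (M := C₁ * C₀) (by simp)
          (measurable_deriv g).aestronglyMeasurable ?_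
        refine (MeasureTheory.ae_restrict_iff' measurableSet_Ioc).mpr
          (Eventually.of_forall fun u hu => ?_)
        rw [(hgd u hu.1.le).deriv]
        refine (hgb u hu.1.le).trans ?_
        have : 1 ≤ u := by linarith [hu.1]
        gcongr
        exact div_le_self hC0 (by nlinarith)
      refine h1.congr fun u hu => ?_
      rw [Set.uIoc_of_le hT] at hu
      exact (hgd u hu.1.le).deriv
    have hparts := intervalIntegral.integral_mul_deriv_eq_deriv_mul (a := A) (b := T)
      (u := g) (v := J) (u' := fun u => g u * r u) (v' := k)
      (fun u hu => hgd u (by rw [Set.uIcc_of_le hT] at hu; exact hu.1))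
      (fun u hu => hJd u (by rw [Set.uIcc_of_le hT] at hu; exact hu.1))
      hgint (hkon T hT).intervalIntegrable
    have hEq : ∫ t in A..T, gammaKernel b c d t * Complex.exp (Complex.I * ((L * t : ℝ) : ℂ)) =
        ∫ t in A..T, g t * k t := by
      refine intervalIntegral.integral_congr fun t ht => ?_
      rw [Set.uIcc_of_le hT] at ht
      rw [hgK t (by linarith [ht.1]), hk]
      simp only
      rw [mul_assoc, mul_assoc, ← Complex.exp_add]
      congr 3
      push_cast; ring
    have hJA : J A = 0 := by simp [hJ]
    rw [hEq, hparts, hJA, mul_zero, sub_zero]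
    have hT0 : 0 < T := by linarith
    have hint : ∫ u in A..T, 10 * C₁ * C₀ * (1 / u ^ 2) ≤ 10 * C₁ * C₀ := by
      have : ∫ u in A..T, 10 * C₁ * C₀ * (1 / u ^ 2) = 10 * C₁ * C₀ * (A⁻¹ - T⁻¹) := by
        rw [intervalIntegral.integral_const_mul]
        congr 1
        have := intervalIntegral.integral_eq_sub_of_hasDerivAt (a := A) (b := T)
          (f := fun u => -u⁻¹) (f' := fun u => 1 / u ^ 2) (fun u hu => by
            rw [Set.uIcc_of_le hT] at hu
            have : u ≠ 0 := by linarith [hu.1]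
            refine (hasDerivAt_inv this).fun_neg.congr_deriv (by field_simp)) (by
            refine ContinuousOn.intervalIntegrable fun u hu => ?_
            rw [Set.uIcc_of_le hT] at hu
            have : u ^ 2 ≠ 0 := by have : 0 < u := by linarith [hu.1]
                                   positivity
            exact (continuousAt_const.div (continuousAt_id.pow 2) this).continuousWithinAt)
        rw [this]; ring
      rw [this]
      have h1 : A⁻¹ ≤ 1 := inv_le_one_of_one_le₀ hA1
      have h2 : 0 < T⁻¹ := by positivity
      nlinarith [mul_nonneg hC1 hC0]
    calc _ ≤ ‖g T * J T‖ + ‖∫ u in A..T, g u * r u * J u‖ := norm_sub_le _ _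
      _ ≤ C₁ * 10 + ∫ u in A..T, 10 * C₁ * C₀ * (1 / u ^ 2) := by
          gcongr
          · rw [norm_mul]
            exact mul_le_mul (hA T hT).1.1 (hJb T hT) (norm_nonneg _) hC1
          · refine intervalIntegral.norm_integral_le_of_norm_le hT
              (Eventually.of_forall fun u hu => ?_) ?_
            · rw [norm_mul]
              calc _ ≤ C₁ * (C₀ / u ^ 2) * 10 := by
                    gcongr
                    · exact hgb u hu.1.le
                    · exact hJb u hu.1.le
                _ = _ := by ring
            · refine ContinuousOn.intervalIntegrable fun u hu => ?_
              rw [Set.uIcc_of_le hT] at hu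
              have : u ^ 2 ≠ 0 := by have : 0 < u := by linarith [hu.1]
                                     positivity
              exact (continuousAt_const.mul
                (continuousAt_const.div (continuousAt_id.pow 2) this)).continuousWithinAt
      _ ≤ _ := by linarith
  have hhalf : ∀ L T : ℝ, 0 ≤ T →
      ‖∫ t in (0 : ℝ)..T, gammaKernel b c d t * Complex.exp (Complex.I * ((L * t : ℝ) : ℂ))‖ ≤
        M + (10 * C₁ + 10 * C₁ * C₀) := by
    intro L T hT
    have hCC := mul_nonneg hC1 hC0
    rcases le_total T A with h1 | h1
    · have := hsmall L T hT h1
      linarith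
    · rw [← intervalIntegral.integral_add_adjacent_intervals
        ((hcontL L).intervalIntegrable 0 A) ((hcontL L).intervalIntegrable A T)]
      exact (norm_add_le _ _).trans (add_le_add (hsmall L A (by linarith) le_rfl) (hlarge L T h1))
  refine ⟨(M + (10 * C₁ + 10 * C₁ * C₀)) + (M + (10 * C₁ + 10 * C₁ * C₀)), fun L T hT => ?_⟩
  rw [← intervalIntegral.integral_add_adjacent_intervals
        ((hcontL L).intervalIntegrable (-T) 0) ((hcontL L).intervalIntegrable 0 T)]
  refine (norm_add_le _ _).trans (add_le_add ?_ (hhalf L T hT))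
  have e1 : ∫ t in (-T)..0, gammaKernel b c d t * Complex.exp (Complex.I * ((L * t : ℝ) : ℂ)) =
      ∫ t in (0 : ℝ)..T, (starRingEnd ℂ)
        (gammaKernel b c d t * Complex.exp (Complex.I * ((L * t : ℝ) : ℂ))) := by
    rw [← neg_zero, ← intervalIntegral.integral_comp_neg]
    simp only [neg_zero]
    refine intervalIntegral.integral_congr fun t _ => ?_
    simp only [gammaKernel_neg, map_mul, ← Complex.exp_conj, Complex.conj_I, Complex.conj_ofReal]
    congr 2
    push_cast; ring
  have e2 : ∫ t in (0 : ℝ)..T, (starRingEnd ℂ)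
        (gammaKernel b c d t * Complex.exp (Complex.I * ((L * t : ℝ) : ℂ))) = (starRingEnd ℂ)
      (∫ t in (0 : ℝ)..T, gammaKernel b c d t * Complex.exp (Complex.I * ((L * t : ℝ) : ℂ))) := by
    rw [intervalIntegral.integral_of_le hT, intervalIntegral.integral_of_le hT]
    exact integral_conj
  rw [e1, e2, RCLike.norm_conj]
  exact hhalf L T hT

/-- An absolutely convergent sum of exponentials `∑ cᵢ exp(i ℓᵢ t)`. -/
def IsAbsExpSum (f : ℝ → ℂ) : Prop :=
  ∃ (ι : Type) (c : ι → ℂ) (ℓ : ι → ℝ), Countable ι ∧ (Summable fun i => ‖c i‖) ∧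
    ∀ t, HasSum (fun i => c i * Complex.exp (Complex.I * ((ℓ i * t : ℝ) : ℂ))) (f t)

theorem norm_exp_I_mul_ofReal_eq_one (x : ℝ) : ‖Complex.exp (Complex.I * (x : ℂ))‖ = 1 := by
  rw [mul_comm, Complex.norm_exp_ofReal_mul_I]

namespace IsAbsExpSum

theorem const (c : ℂ) : IsAbsExpSum fun _ => c :=
  ⟨Unit, fun _ => c, fun _ => 0, inferInstance, (hasSum_fintype _).summable, fun t => by
    simp⟩

theorem exp (ℓ : ℝ) : IsAbsExpSum fun t => Complex.exp (Complex.I * ((ℓ * t : ℝ) : ℂ)) :=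
  ⟨Unit, fun _ => 1, fun _ => ℓ, inferInstance, (hasSum_fintype _).summable, fun t => by
    simp⟩

theorem mul {f g : ℝ → ℂ} (hf : IsAbsExpSum f) (hg : IsAbsExpSum g) :
    IsAbsExpSum fun t => f t * g t := by
  obtain ⟨ι, c, ℓ, hι, hc, hs⟩ := hf
  obtain ⟨κ, d, m, hκ, hd, ht⟩ := hg
  refine ⟨ι × κ, fun p => c p.1 * d p.2, fun p => ℓ p.1 + m p.2, inferInstance, ?_, fun t => ?_⟩
  · exact Summable.mul_norm (f := c) (g := d) hc hd
  · have h1 : Summable fun i => ‖c i * Complex.exp (Complex.I * ((ℓ i * t : ℝ) : ℂ))‖ := by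
      simpa only [norm_mul, norm_exp_I_mul_ofReal_eq_one, mul_one] using hc
    have h2 : Summable fun i => ‖d i * Complex.exp (Complex.I * ((m i * t : ℝ) : ℂ))‖ := by
      simpa only [norm_mul, norm_exp_I_mul_ofReal_eq_one, mul_one] using hd
    have h4 := summable_mul_of_summable_norm h1 h2
    have h3 := (hs t).mul (ht t) h4
    refine h3.congr_fun ?_
    intro p
    rw [mul_mul_mul_comm, ← Complex.exp_add]
    congr 2
    push_cast; ring

theorem exists_bound {f : ℝ → ℂ} (hf : IsAbsExpSum f) : ∃ C, ∀ t, ‖f t‖ ≤ C := by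
  obtain ⟨ι, c, ℓ, -, hc, hs⟩ := hf
  refine ⟨∑' i, ‖c i‖, fun t => ?_⟩
  rw [← (hs t).tsum_eq]
  refine tsum_of_norm_bounded hc.hasSum fun i => ?_
  simp only [norm_mul, norm_exp_I_mul_ofReal_eq_one, mul_one, le_refl]

theorem exists_norm_integral_le {f K : ℝ → ℂ} (hf : IsAbsExpSum f) (hK : Continuous K)
    (h : ∃ C, ∀ L T : ℝ, 0 ≤ T →
      ‖∫ t in (-T)..T, K t * Complex.exp (Complex.I * ((L * t : ℝ) : ℂ))‖ ≤ C) :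
    ∃ C, ∀ L T : ℝ, 0 ≤ T →
      ‖∫ t in (-T)..T, K t * f t * Complex.exp (Complex.I * ((L * t : ℝ) : ℂ))‖ ≤ C := by
  obtain ⟨ι, c, ℓ, hι, hc, hs⟩ := hf
  obtain ⟨C, hC⟩ := h
  refine ⟨∑' i, ‖c i‖ * C, fun L T hT => ?_⟩
  have key := intervalIntegral.hasSum_integral_of_dominated_convergence
    (μ := MeasureTheory.volume) (a := -T) (b := T)
    (F := fun i t => c i * (K t * Complex.exp (Complex.I * (((ℓ i + L) * t : ℝ) : ℂ))))
    (f := fun t => K t * f t * Complex.exp (Complex.I * ((L * t : ℝ) : ℂ)))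
    (fun i t => ‖c i‖ * ‖K t‖)
    (fun i => by
      have : Continuous fun t : ℝ =>
        c i * (K t * Complex.exp (Complex.I * (((ℓ i + L) * t : ℝ) : ℂ))) := by fun_prop
      exact this.aestronglyMeasurable)
    (fun i => Eventually.of_forall fun t _ => by
      simp only [norm_mul, norm_exp_I_mul_ofReal_eq_one, mul_one, le_refl])
    (Eventually.of_forall fun t _ => hc.mul_right _)
    (by
      simp only [tsum_mul_right]
      exact (continuous_const.mul hK.norm).intervalIntegrable _ _)
    (Eventually.of_forall fun t _ => by
      refine (((hs t).mul_left (K t)).mul_right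
        (Complex.exp (Complex.I * ((L * t : ℝ) : ℂ)))).congr_fun fun i => ?_
      rw [show (((ℓ i + L) * t : ℝ) : ℂ) = ((ℓ i * t : ℝ) : ℂ) + ((L * t : ℝ) : ℂ) by
        push_cast; ring,
        mul_add, Complex.exp_add]
      ring)
  rw [← key.tsum_eq]
  refine tsum_of_norm_bounded (hc.mul_right C).hasSum fun i => ?_
  rw [intervalIntegral.integral_const_mul, norm_mul]
  gcongr
  exact hC _ _ hT

end IsAbsExpSum

theorem Complex.ofReal_cpow_add_mul_I {x : ℝ} (hx : 0 < x) (a t : ℝ) :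
    (x : ℂ) ^ ((a : ℂ) + t * Complex.I) =
      ((x ^ a : ℝ) : ℂ) * Complex.exp (Complex.I * ((Real.log x * t : ℝ) : ℂ)) := by
  rw [Complex.cpow_add _ _ (by exact_mod_cast hx.ne'), ← Complex.ofReal_cpow hx.le,
    Complex.cpow_def_of_ne_zero (x := (x : ℂ)) (by exact_mod_cast hx.ne'),
    ← Complex.ofReal_log hx.le]
  congr 2
  push_cast; ring

theorem IsAbsExpSum.of_hasSum_cpow {ι : Type} [Countable ι] {c : ι → ℂ} {x : ι → ℝ}
    {f : ℝ → ℂ} {σ : ℝ} (hσ : 0 < σ) (hx : ∀ i, 0 ≤ x i)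
    (hs : ∀ t : ℝ, HasSum (fun i => c i / (x i : ℂ) ^ ((σ : ℂ) - 2 * t * Complex.I)) (f t)) :
    IsAbsExpSum f := by
  refine ⟨ι, fun i => c i / (x i : ℂ) ^ (σ : ℂ), fun i => 2 * Real.log (x i), inferInstance, ?_,
    fun t => (hs t).congr_fun fun i => ?_⟩
  · have := (hs 0).summable.norm
    simpa using this
  · rcases (hx i).eq_or_lt with h | h
    · have h0 : (σ : ℂ) - 2 * t * Complex.I ≠ 0 := fun h0 => by
        have := congrArg Complex.re h0
        simp at this
        exact hσ.ne' this
      simp only [← h, Complex.ofReal_zero, Complex.zero_cpow h0,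
        Complex.zero_cpow (Complex.ofReal_ne_zero.mpr hσ.ne'), div_zero, zero_mul]
    · beta_reduce
      rw [show (σ : ℂ) - 2 * t * Complex.I = (σ : ℂ) + ((-2 * t : ℝ) : ℂ) * Complex.I by
        push_cast; ring, Complex.ofReal_cpow_add_mul_I h, ← Complex.ofReal_cpow h.le,
        div_mul_eq_div_div, div_eq_mul_inv (_ / _) (Complex.exp _), ← Complex.exp_neg]
      congr 2
      push_cast; ring

theorem isAbsExpSum_hurwitzZetaEven (a : ℝ) {σ : ℝ} (hσ : 1 < σ) :
    IsAbsExpSum fun t => HurwitzZeta.hurwitzZetaEven a ((σ : ℂ) - 2 * t * Complex.I) := by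
  refine IsAbsExpSum.of_hasSum_cpow (ι := ℤ) (c := fun _ => 1 / 2) (x := fun n => |n + a|)
    (zero_lt_one.trans hσ) (fun _ => abs_nonneg _) fun t => ?_
  refine (HurwitzZeta.hasSum_int_hurwitzZetaEven a (by simpa using hσ)).congr_fun fun n => ?_
  rw [div_right_comm]

theorem isAbsExpSum_LFunction {N : ℕ} [NeZero N] (χ : DirichletCharacter ℂ N) {σ : ℝ}
    (hσ : 1 < σ) :
    IsAbsExpSum fun t => χ.LFunction ((σ : ℂ) - 2 * t * Complex.I) := by
  refine IsAbsExpSum.of_hasSum_cpow (ι := ℕ) (c := fun n => χ n) (x := fun n => n)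
    (zero_lt_one.trans hσ) (fun _ => by positivity) fun t => ?_
  have hre : 1 < ((σ : ℂ) - 2 * t * Complex.I).re := by simpa using hσ
  have h0 : (σ : ℂ) - 2 * t * Complex.I ≠ 0 := fun h => by
    rw [h] at hre; simp at hre; linarith
  rw [χ.LFunction_eq_LSeries hre]
  refine (χ.LSeriesSummable_of_one_lt_re hre).LSeriesHasSum.congr_fun fun n => ?_
  rw [LSeries.term_of_ne_zero' h0]
  simp

open HurwitzZeta DirichletCharacter in
/-- `(s - 1) ζ(s) · ∑ cos(2πna) n⁻ˢ · L(s, χ)` times the Mellin transform of `(1 - u²)₊^ρ`. -/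
noncomputable def twistedZetaMellin {N : ℕ} [NeZero N] (χ : DirichletCharacter ℂ N) (a ρ : ℝ)
    (s : ℂ) : ℂ :=
  (Real.Gamma (ρ + 1) : ℂ) / 2 * (π : ℂ) ^ (s / 2) * LFunctionTrivChar₁ 1 s * cosZeta a s *
    completedLFunction χ s * (Complex.Gamma (ρ + 1 + s / 2))⁻¹

theorem LFunctionTrivChar₁_one_eq {s : ℂ} (hs : s ≠ 1) :
    DirichletCharacter.LFunctionTrivChar₁ 1 s = (s - 1) * riemannZeta s := by
  rw [DirichletCharacter.LFunctionTrivChar₁, Function.update_of_ne hs,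
    DirichletCharacter.LFunctionTrivChar, DirichletCharacter.LFunction_modOne_eq]

theorem LFunctionTrivChar₁_one_one : DirichletCharacter.LFunctionTrivChar₁ 1 1 = 1 := by
  simp [DirichletCharacter.LFunctionTrivChar₁]

theorem DirichletCharacter.Even.inv {N : ℕ} {χ : DirichletCharacter ℂ N} (h : χ.Even) :
    (χ⁻¹).Even := by
  rw [DirichletCharacter.Even] at *
  rw [MulChar.inv_apply_eq_inv', h, inv_one]

theorem completedLFunction_even_eq {N : ℕ} [NeZero N] {χ : DirichletCharacter ℂ N}
    (h : χ.Even) {s : ℂ} (hs : 0 < s.re) :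
    χ.completedLFunction s = χ.LFunction s * Complex.Gammaℝ s := by
  rw [χ.LFunction_eq_completed_div_gammaFactor s (Or.inl fun h => by simp [h] at hs),
    h.gammaFactor_def, div_mul_cancel₀ _ (Complex.Gammaℝ_ne_zero_of_re_pos hs)]

theorem twistedZetaMellin_div_eq {N : ℕ} [NeZero N] {χ : DirichletCharacter ℂ N}
    (heven : χ.Even) (hprim : χ.IsPrimitive) (a ρ : ℝ) {s : ℂ} (hs : s.re < 0) :
    twistedZetaMellin χ a ρ s / (s - 1) =
      (Real.Gamma (ρ + 1) : ℂ) / 2 * χ.rootNumber * (π : ℂ) ^ (3 * s - 3 / 2) *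
        (N : ℂ) ^ (1 / 2 - s) *
        (Complex.Gamma ((1 - s) / 2) ^ 3 * ((Complex.Gamma (s / 2))⁻¹ ^ 2 *
          (Complex.Gamma (ρ + 1 + s / 2))⁻¹)) *
        (HurwitzZeta.hurwitzZetaEven (0 : ℝ) (1 - s) * HurwitzZeta.hurwitzZetaEven a (1 - s) *
          χ⁻¹.LFunction (1 - s)) := by
  have hs1 : s ≠ 1 := fun h => by simp [h] at hs; linarith
  have hs0 : s ≠ 0 := fun h => by simp [h] at hs
  have hw : 0 < (1 - s).re := by simp; linarith
  have hw0 : 1 - s ≠ 0 := sub_ne_zero.mpr hs1.symm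
  have hG := Complex.Gammaℝ_ne_zero_of_re_pos hw
  have e1 : ∀ α : ℝ, HurwitzZeta.cosZeta α s =
      HurwitzZeta.hurwitzZetaEven α (1 - s) * Complex.Gammaℝ (1 - s) / Complex.Gammaℝ s := by
    intro α
    rw [HurwitzZeta.hurwitzZetaEven_def_of_ne_or_ne (Or.inr hw0), div_mul_cancel₀ _ hG,
      HurwitzZeta.completedHurwitzZetaEven_one_sub, HurwitzZeta.cosZeta, Function.update_of_ne hs0]
  have e2 : riemannZeta s = HurwitzZeta.cosZeta (0 : ℝ) s := by
    rw [← HurwitzZeta.cosZeta_zero]; rfl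
  have e3 : χ.completedLFunction s =
      (N : ℂ) ^ (1 / 2 - s) * χ.rootNumber * (χ⁻¹.LFunction (1 - s) * Complex.Gammaℝ (1 - s)) := by
    have := hprim.completedLFunction_one_sub (1 - s)
    rw [sub_sub_cancel, completedLFunction_even_eq heven.inv hw] at this
    rw [this]
    congr 3
    ring
  have hπ : (π : ℂ) ≠ 0 := by exact_mod_cast Real.pi_ne_zero
  have e4 : (π : ℂ) ^ (s / 2) * (Complex.Gammaℝ (1 - s) ^ 3 * (Complex.Gammaℝ s)⁻¹ ^ 2) =
      (π : ℂ) ^ (3 * s - 3 / 2) *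
        (Complex.Gamma ((1 - s) / 2) ^ 3 * (Complex.Gamma (s / 2))⁻¹ ^ 2) := by
    simp only [Complex.Gammaℝ_def, mul_inv, mul_pow, ← Complex.cpow_neg]
    rw [show 3 * s - 3 / 2 = s / 2 + (3 * (-(1 - s) / 2) + 2 * (- (-s / 2))) by ring,
      Complex.cpow_add _ _ hπ, Complex.cpow_add _ _ hπ]
    rw [show (3 : ℂ) = ((3 : ℕ) : ℂ) by norm_num, Complex.cpow_nat_mul]
    rw [show (2 : ℂ) * (- (-s / 2)) = ((2 : ℕ) : ℂ) * (- (-s / 2)) by norm_num,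
      Complex.cpow_nat_mul]
    ring
  rw [twistedZetaMellin, LFunctionTrivChar₁_one_eq hs1, e2, e1, e1, e3]
  have h1 : s - 1 ≠ 0 := sub_ne_zero.mpr hs1
  rw [div_eq_iff h1]
  linear_combination (Real.Gamma (ρ + 1) : ℂ) / 2 * χ.rootNumber * (N : ℂ) ^ (1 / 2 - s) *
    (Complex.Gamma (ρ + 1 + s / 2))⁻¹ * (HurwitzZeta.hurwitzZetaEven (0 : ℝ) (1 - s) *
      HurwitzZeta.hurwitzZetaEven a (1 - s) * χ⁻¹.LFunction (1 - s)) * (s - 1) * e4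

theorem exists_isAbsExpSum_twistedZetaMellin {N : ℕ} [NeZero N] {χ : DirichletCharacter ℂ N}
    (heven : χ.Even) (hprim : χ.IsPrimitive) (a ρ : ℝ) {σ : ℝ} (hσ : σ < 0) :
    ∃ f, IsAbsExpSum f ∧ ∀ t : ℝ,
      twistedZetaMellin χ a ρ (σ + 2 * t * Complex.I) / (σ + 2 * t * Complex.I - 1) =
        gammaKernel ((1 - σ) / 2) (σ / 2) (ρ + 1 + σ / 2) t * f t := by
  have h1 : 1 < 1 - σ := by linarith
  have hN : (0 : ℝ) < N := by exact_mod_cast Nat.pos_of_ne_zero (NeZero.ne N)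
  refine ⟨_, (((IsAbsExpSum.const ((Real.Gamma (ρ + 1) : ℂ) / 2 * χ.rootNumber *
    ((π ^ (3 * σ - 3 / 2) : ℝ) : ℂ) * (((N : ℝ) ^ (1 / 2 - σ) : ℝ) : ℂ))).mul
    (IsAbsExpSum.exp (Real.log π * 6))).mul (IsAbsExpSum.exp (Real.log N * (-2)))).mul
    (((isAbsExpSum_hurwitzZetaEven 0 h1).mul (isAbsExpSum_hurwitzZetaEven a h1)).mul
      (isAbsExpSum_LFunction χ⁻¹ h1)), fun t => ?_⟩
  have hre : ((σ : ℂ) + 2 * t * Complex.I).re < 0 := by simpa using hσ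
  rw [twistedZetaMellin_div_eq heven hprim a ρ hre]
  have e1 : (π : ℂ) ^ (3 * ((σ : ℂ) + 2 * t * Complex.I) - 3 / 2) =
      ((π ^ (3 * σ - 3 / 2) : ℝ) : ℂ) *
        Complex.exp (Complex.I * ((Real.log π * 6 * t : ℝ) : ℂ)) := by
    rw [mul_assoc (Real.log π), ← Complex.ofReal_cpow_add_mul_I Real.pi_pos]
    congr 1; push_cast; ring
  have e2 : (N : ℂ) ^ (1 / 2 - ((σ : ℂ) + 2 * t * Complex.I)) =
      (((N : ℝ) ^ (1 / 2 - σ) : ℝ) : ℂ) *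
        Complex.exp (Complex.I * ((Real.log N * (-2) * t : ℝ) : ℂ)) := by
    rw [mul_assoc (Real.log N), ← Complex.ofReal_cpow_add_mul_I hN]
    congr 1; push_cast; ring
  have e3 : (1 : ℂ) - (σ + 2 * t * Complex.I) = ((1 - σ : ℝ) : ℂ) - 2 * t * Complex.I := by
    push_cast; ring
  have e4 : (((1 - σ : ℝ) : ℂ) - 2 * t * Complex.I) / 2 =
      (((1 - σ) / 2 : ℝ) : ℂ) - t * Complex.I := by push_cast; ring
  have e5 : ((σ : ℂ) + 2 * t * Complex.I) / 2 = ((σ / 2 : ℝ) : ℂ) + t * Complex.I := by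
    push_cast; ring
  have e6 : (ρ : ℂ) + 1 + (((σ / 2 : ℝ) : ℂ) + t * Complex.I) =
      ((ρ + 1 + σ / 2 : ℝ) : ℂ) + t * Complex.I := by push_cast; ring
  rw [e1, e2, e3, e4, e5, e6, gammaKernel]
  ring

theorem exists_norm_twistedZetaMellin_left {N : ℕ} [NeZero N] {χ : DirichletCharacter ℂ N}
    (heven : χ.Even) (hprim : χ.IsPrimitive) (a : ℝ) {ρ : ℝ} (hρ : 1 < ρ) :
    ∃ C, ∀ t : ℝ,
      ‖twistedZetaMellin χ a ρ (((1 - ρ) / 3 : ℝ) + t * Complex.I) /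
        (((1 - ρ) / 3 : ℝ) + t * Complex.I - 1)‖ ≤ C * (1 + |t|) ^ (-(1 / 2) : ℝ) := by
  have hσ : (1 - ρ) / 3 < 0 := by linarith
  obtain ⟨f, hf, hfe⟩ := exists_isAbsExpSum_twistedZetaMellin heven hprim a ρ hσ
  obtain ⟨D, hD⟩ := hf.exists_bound
  obtain ⟨C, hC⟩ := exists_norm_gammaKernel_le (b := (1 - (1 - ρ) / 3) / 2) (c := (1 - ρ) / 3 / 2)
    (d := ρ + 1 + (1 - ρ) / 3 / 2) (by linarith) (by ring)
  have hC0 : 0 ≤ C := by simpa using (norm_nonneg _).trans (hC 0)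
  refine ⟨C * 2 ^ (1 / 2 : ℝ) * D, fun t => ?_⟩
  have h1 := hfe (t / 2)
  rw [show (2 : ℂ) * ((t / 2 : ℝ) : ℂ) = t by push_cast; ring] at h1
  rw [h1, norm_mul]
  have h2 : (1 + |t / 2|) ^ (-(1 / 2) : ℝ) ≤ 2 ^ (1 / 2 : ℝ) * (1 + |t|) ^ (-(1 / 2) : ℝ) := by
    have h3 : (2 : ℝ) ^ (1 / 2 : ℝ) = (1 / 2 : ℝ) ^ (-(1 / 2) : ℝ) := by
      rw [one_div, ← one_div, Real.rpow_neg (by norm_num), ← Real.inv_rpow (by norm_num)]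
      norm_num
    rw [h3, ← Real.mul_rpow (by norm_num) (by positivity)]
    refine Real.rpow_le_rpow_of_nonpos (by positivity) ?_ (by norm_num)
    rw [abs_div, abs_two]
    linarith
  calc _ ≤ C * (1 + |t / 2|) ^ (-(1 / 2) : ℝ) * D := by
        gcongr
        · exact hC _
        · exact hD _
    _ ≤ C * (2 ^ (1 / 2 : ℝ) * (1 + |t|) ^ (-(1 / 2) : ℝ)) * D := by
        gcongr
        exact (norm_nonneg _).trans (hD 0)
    _ = _ := by ring

theorem exists_norm_integral_twistedZetaMellin_left {N : ℕ} [NeZero N]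
    {χ : DirichletCharacter ℂ N} (heven : χ.Even) (hprim : χ.IsPrimitive) (a : ℝ) {ρ : ℝ}
    (hρ : 1 < ρ) :
    ∃ C, ∀ x T : ℝ, 0 < x → 0 ≤ T →
      ‖∫ t in (-T)..T, twistedZetaMellin χ a ρ (((1 - ρ) / 3 : ℝ) + t * Complex.I) /
        (((1 - ρ) / 3 : ℝ) + t * Complex.I - 1) *
          (x : ℂ) ^ (((1 - ρ) / 3 : ℝ) + t * Complex.I)‖ ≤ C * x ^ ((1 - ρ) / 3) := by
  have hσ : (1 - ρ) / 3 < 0 := by linarith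
  obtain ⟨f, hf, hfe⟩ := exists_isAbsExpSum_twistedZetaMellin heven hprim a ρ hσ
  have hb : 0 < (1 - (1 - ρ) / 3) / 2 := by linarith
  obtain ⟨C, hC⟩ := hf.exists_norm_integral_le (continuous_gammaKernel hb _ _)
    (exists_norm_integral_gammaKernel_le (b := (1 - (1 - ρ) / 3) / 2) (c := (1 - ρ) / 3 / 2)
    (d := ρ + 1 + (1 - ρ) / 3 / 2) hb (by ring))
  refine ⟨2 * C, fun x T hx hT => ?_⟩
  obtain ⟨G, hG⟩ : ∃ G : ℝ → ℂ, ∀ u, G u = gammaKernel ((1 - (1 - ρ) / 3) / 2)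
      ((1 - ρ) / 3 / 2) (ρ + 1 + (1 - ρ) / 3 / 2) u * f u *
        Complex.exp (Complex.I * ((2 * Real.log x * u : ℝ) : ℂ)) := ⟨_, fun _ => rfl⟩
  have key : ∀ t : ℝ, twistedZetaMellin χ a ρ (((1 - ρ) / 3 : ℝ) + t * Complex.I) /
        (((1 - ρ) / 3 : ℝ) + t * Complex.I - 1) *
          (x : ℂ) ^ ((((1 - ρ) / 3 : ℝ) : ℂ) + t * Complex.I) =
      ((x ^ ((1 - ρ) / 3) : ℝ) : ℂ) * G (t / 2) := by
    intro t
    have h1 := hfe (t / 2)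
    rw [show (2 : ℂ) * ((t / 2 : ℝ) : ℂ) = t by push_cast; ring] at h1
    rw [h1, Complex.ofReal_cpow_add_mul_I hx, hG,
      show 2 * Real.log x * (t / 2) = Real.log x * t by ring]
    ring
  rw [intervalIntegral.integral_congr fun t _ => key t, intervalIntegral.integral_const_mul,
    intervalIntegral.integral_comp_div _ two_ne_zero,
    norm_mul, norm_smul, Complex.norm_real, Real.norm_of_nonneg (by positivity), neg_div]
  have := hC (2 * Real.log x) (T / 2) (by positivity)
  simp_rw [← hG] at this
  calc _ ≤ x ^ ((1 - ρ) / 3) * (‖(2 : ℝ)‖ * C) := by gcongr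
    _ = _ := by rw [Real.norm_two]; ring

/-- At most exponential growth in `|Im s|` on vertical strips, away from the real axis. -/
def HasExpGrowthOnStrips (f : ℂ → ℂ) : Prop :=
  ∀ α β : ℝ, ∃ C B T : ℝ, ∀ s : ℂ, α ≤ s.re → s.re ≤ β → T ≤ |s.im| →
    ‖f s‖ ≤ C * Real.exp (B * |s.im|)

namespace HasExpGrowthOnStrips

variable {f g : ℂ → ℂ}

theorem congr_of_im_ne_zero (hf : HasExpGrowthOnStrips f) (h : ∀ s : ℂ, s.im ≠ 0 → g s = f s) :
    HasExpGrowthOnStrips g := by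
  intro α β
  obtain ⟨C, B, T, H⟩ := hf α β
  refine ⟨C, B, max T 1, fun s h1 h2 h3 => ?_⟩
  rw [h s (abs_pos.mp (lt_of_lt_of_le one_pos ((le_max_right _ _).trans h3)))]
  exact H s h1 h2 ((le_max_left _ _).trans h3)

theorem mul (hf : HasExpGrowthOnStrips f) (hg : HasExpGrowthOnStrips g) :
    HasExpGrowthOnStrips fun s => f s * g s := by
  intro α β
  obtain ⟨C, B, T, H⟩ := hf α β
  obtain ⟨C', B', T', H'⟩ := hg α β
  refine ⟨C * C', B + B', max T T', fun s h1 h2 h3 => ?_⟩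
  have i1 := H s h1 h2 ((le_max_left _ _).trans h3)
  have i2 := H' s h1 h2 ((le_max_right _ _).trans h3)
  rw [norm_mul, add_mul, Real.exp_add, mul_mul_mul_comm]
  exact mul_le_mul i1 i2 (norm_nonneg _) ((norm_nonneg _).trans i1)

theorem add (hf : HasExpGrowthOnStrips f) (hg : HasExpGrowthOnStrips g) :
    HasExpGrowthOnStrips fun s => f s + g s := by
  intro α β
  obtain ⟨C, B, T, H⟩ := hf α β
  obtain ⟨C', B', T', H'⟩ := hg α β
  refine ⟨|C| + |C'|, max B B', max T T', fun s h1 h2 h3 => ?_⟩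
  have i1 := H s h1 h2 ((le_max_left _ _).trans h3)
  have i2 := H' s h1 h2 ((le_max_right _ _).trans h3)
  refine (norm_add_le _ _).trans ?_
  rw [add_mul]
  refine add_le_add (i1.trans ?_) (i2.trans ?_)
  · gcongr
    exacts [le_abs_self _, le_max_left _ _]
  · gcongr
    exacts [le_abs_self _, le_max_right _ _]

theorem of_norm_le_re {φ : ℝ → ℝ} (hφ : Continuous φ) (h : ∀ s, 1 ≤ |s.im| → ‖f s‖ ≤ φ s.re) :
    HasExpGrowthOnStrips f := by
  intro α β
  obtain ⟨C, hC⟩ := isCompact_Icc.exists_bound_of_continuousOn (s := Set.Icc α β) hφ.continuousOn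
  refine ⟨C, 0, 1, fun s h1 h2 h3 => ?_⟩
  rw [zero_mul, Real.exp_zero, mul_one]
  exact (h s h3).trans ((le_abs_self _).trans (hC s.re ⟨h1, h2⟩))

theorem const (c : ℂ) : HasExpGrowthOnStrips fun _ => c :=
  of_norm_le_re (φ := fun _ => ‖c‖) continuous_const fun _ _ => le_rfl

theorem ofReal_cpow {x : ℝ} (hx : 0 < x) : HasExpGrowthOnStrips fun s => (x : ℂ) ^ s :=
  of_norm_le_re (φ := fun σ => x ^ σ) (Real.continuous_const_rpow hx.ne') fun s _ => by
    rw [Complex.norm_cpow_eq_rpow_re_of_pos hx]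

theorem id : HasExpGrowthOnStrips fun s => s := by
  intro α β
  refine ⟨max |α| |β| + 1, 1, 0, fun s h1 h2 _ => (Complex.norm_le_abs_re_add_abs_im s).trans ?_⟩
  have h3 : |s.re| ≤ max |α| |β| := abs_le_max_abs_abs h1 h2
  have h4 := Real.add_one_le_exp |s.im|
  have h5 := abs_nonneg s.im
  have h6 : 0 ≤ max |α| |β| := (abs_nonneg _).trans h3
  rw [one_mul]
  nlinarith

theorem one_div_sub (k : ℝ) : HasExpGrowthOnStrips fun s => 1 / (k - s) :=
  of_norm_le_re (φ := fun _ => 1) continuous_const fun s h => by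
    rw [norm_div, norm_one]
    refine div_le_one_of_le₀ (h.trans ?_) (norm_nonneg _)
    have := Complex.abs_im_le_norm (k - s)
    simpa using this

theorem sum {ι : Type*} (t : Finset ι) {F : ι → ℂ → ℂ} (h : ∀ i ∈ t, HasExpGrowthOnStrips (F i)) :
    HasExpGrowthOnStrips fun s => ∑ i ∈ t, F i s := by
  induction t using Finset.induction_on with
  | empty => simpa using const 0
  | insert a t ha ih =>
    simp_rw [Finset.sum_insert ha]
    exact (h _ (Finset.mem_insert_self _ _)).add
      (ih fun i hi => h i (Finset.mem_insert_of_mem hi))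

theorem comp_add_div_two (hf : HasExpGrowthOnStrips f) (d : ℝ) :
    HasExpGrowthOnStrips fun s => f (d + s / 2) := by
  intro α β
  obtain ⟨C, B, T, H⟩ := hf (d + α / 2) (d + β / 2)
  refine ⟨C, B / 2, 2 * T, fun s h1 h2 h3 => ?_⟩
  have him : |((d : ℂ) + s / 2).im| = |s.im| / 2 := by
    simp [abs_div]
  have := H (d + s / 2) (by simp; linarith) (by simp; linarith) (by rw [him]; linarith)
  rw [him] at this
  convert this using 3
  ring

theorem comp_div_two (hf : HasExpGrowthOnStrips f) : HasExpGrowthOnStrips fun s => f (s / 2) := by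
  simpa using hf.comp_add_div_two 0

theorem mellin {φ : ℝ → ℂ} (hφ : ∀ s, MellinConvergent φ s) :
    HasExpGrowthOnStrips (mellin φ) := by
  intro α β
  refine ⟨∫ t in Set.Ioi (0 : ℝ), (‖(t : ℂ) ^ ((α : ℂ) - 1) • φ t‖ +
    ‖(t : ℂ) ^ ((β : ℂ) - 1) • φ t‖), 0, 0, fun s h1 h2 _ => ?_⟩
  rw [zero_mul, Real.exp_zero, mul_one, _root_.mellin]
  refine MeasureTheory.norm_integral_le_of_norm_le ((hφ α).norm.add (hφ β).norm) ?_
  refine (MeasureTheory.ae_restrict_mem measurableSet_Ioi).mono fun t ht => ?_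
  have ht : 0 < t := ht
  simp only [norm_smul, Complex.norm_cpow_eq_rpow_re_of_pos ht, ← add_mul]
  refine mul_le_mul_of_nonneg_right ?_ (norm_nonneg _)
  simp only [Complex.sub_re, Complex.one_re, Complex.ofReal_re]
  rcases le_total 1 t with h | h
  · have := Real.rpow_le_rpow_of_exponent_le h (sub_le_sub_right h2 1)
    have := Real.rpow_nonneg ht.le (α - 1)
    linarith
  · have := Real.rpow_le_rpow_of_exponent_ge ht h (sub_le_sub_right h1 1)
    have := Real.rpow_nonneg ht.le (β - 1)
    linarith

theorem weakFEPair_Λ (P : WeakFEPair ℂ) : HasExpGrowthOnStrips P.Λ := by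
  have h1 : HasExpGrowthOnStrips P.Λ₀ :=
    mellin fun s => (P.isStrongFEPair_toStrongFEPair.hasMellin s).1
  refine ((h1.add ((one_div_sub 0).mul (const P.f₀))).add
    ((one_div_sub P.k).mul (const (-P.ε * P.g₀)))).congr_of_im_ne_zero fun s hs => ?_
  have hs0 : s ≠ 0 := fun h => by simp [h] at hs
  rw [WeakFEPair.Λ, smul_eq_mul, smul_eq_mul, Complex.ofReal_zero, zero_sub]
  field_simp
  ring

theorem completedHurwitzZetaEven (a : UnitAddCircle) :
    HasExpGrowthOnStrips (HurwitzZeta.completedHurwitzZetaEven a) :=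
  ((weakFEPair_Λ _).comp_div_two.mul (const (1 / 2))).congr_of_im_ne_zero fun s _ => by
    rw [HurwitzZeta.completedHurwitzZetaEven, mul_one_div]

theorem completedCosZeta (a : UnitAddCircle) :
    HasExpGrowthOnStrips (HurwitzZeta.completedCosZeta a) :=
  ((weakFEPair_Λ _).comp_div_two.mul (const (1 / 2))).congr_of_im_ne_zero fun s _ => by
    rw [HurwitzZeta.completedCosZeta, mul_one_div]

end HasExpGrowthOnStrips

theorem Complex.norm_sin_le_exp_abs_im (z : ℂ) : ‖Complex.sin z‖ ≤ Real.exp |z.im| := by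
  rw [Complex.sin, norm_div, norm_mul, Complex.norm_I, mul_one, Complex.norm_two,
    div_le_iff₀ two_pos]
  refine (norm_sub_le _ _).trans ?_
  rw [Complex.norm_exp, Complex.norm_exp]
  have h1 : Real.exp (-z * Complex.I).re ≤ Real.exp |z.im| := by
    simpa using le_abs_self z.im
  have h2 : Real.exp (z * Complex.I).re ≤ Real.exp |z.im| := by
    simpa using neg_le_abs z.im
  linarith

theorem norm_inv_Gamma_le_norm_inv_Gamma_sub_nat {s : ℂ} (hs : 1 ≤ |s.im|) (n : ℕ) :
    ‖(Complex.Gamma s)⁻¹‖ ≤ ‖(Complex.Gamma (s - n))⁻¹‖ := by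
  induction n with
  | zero => simp
  | succ n ih =>
    refine ih.trans ?_
    have him : 1 ≤ ‖s - (n + 1 : ℕ)‖ := hs.trans (by
      simpa using Complex.abs_im_le_norm (s - (n + 1 : ℕ)))
    have h0 : s - (n + 1 : ℕ) ≠ 0 := norm_pos_iff.mp (one_pos.trans_le him)
    have h1 : Complex.Gamma (s - n) = (s - (n + 1 : ℕ)) * Complex.Gamma (s - (n + 1 : ℕ)) := by
      rw [← Complex.Gamma_add_one _ h0]
      congr 1; push_cast; ring
    rw [h1, mul_inv, norm_mul, norm_inv]
    exact mul_le_of_le_one_left (norm_nonneg _) (inv_le_one_of_one_le₀ him)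

theorem hasExpGrowthOnStrips_inv_Gamma :
    HasExpGrowthOnStrips fun s => (Complex.Gamma s)⁻¹ := by
  intro α β
  obtain ⟨n, hn⟩ := exists_nat_ge β
  obtain ⟨C, hC⟩ := isCompact_Icc.exists_bound_of_continuousOn
    (s := Set.Icc (1 - β + n) (1 - α + n)) (f := Real.Gamma) (by
      intro x hx
      refine (Real.differentiableAt_Gamma fun m => ?_).continuousAt.continuousWithinAt
      have h1 := hx.1
      have : (0 : ℝ) ≤ m := by positivity
      intro h
      linarith)
  refine ⟨C / π, π, 1, fun s h1 h2 h3 => ?_⟩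
  refine (norm_inv_Gamma_le_norm_inv_Gamma_sub_nat h3 n).trans ?_
  have hre : 0 < (1 - (s - n)).re := by simp; linarith
  have hG : Complex.Gamma (1 - (s - n)) ≠ 0 := Complex.Gamma_ne_zero_of_re_pos hre
  have e : (Complex.Gamma (s - n))⁻¹ =
      Complex.Gamma (1 - (s - n)) * Complex.sin (π * (s - n)) / π := by
    have h := Complex.Gamma_mul_Gamma_one_sub (s - n)
    have hπ : (π : ℂ) ≠ 0 := by exact_mod_cast Real.pi_ne_zero
    have hs : Complex.sin (π * (s - n)) ≠ 0 := by
      rw [Complex.sin_ne_zero_iff]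
      intro k hk
      have := congrArg Complex.im hk
      simp [Real.pi_ne_zero] at this
      rw [this] at h3
      norm_num at h3
    have hg : Complex.Gamma (s - n) ≠ 0 := by
      intro h0
      rw [h0, zero_mul, eq_comm, div_eq_zero_iff] at h
      tauto
    rw [eq_div_iff hs] at h
    rw [eq_div_iff hπ, inv_mul_eq_iff_eq_mul₀ hg, ← mul_assoc]
    exact h.symm
  rw [e, norm_div, norm_mul, Complex.norm_real, Real.norm_of_nonneg Real.pi_pos.le,
    div_mul_eq_mul_div]
  gcongr
  · refine (norm_nonneg _).trans (hC (1 - β + n) ⟨le_rfl, ?_⟩)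
    linarith
  · refine (Complex.norm_Gamma_le_Gamma_re hre).trans ((le_abs_self _).trans (hC _ ⟨?_, ?_⟩)) <;>
    · simp; linarith
  · refine (Complex.norm_sin_le_exp_abs_im _).trans (Real.exp_le_exp.mpr ?_)
    simp [abs_mul, abs_of_pos Real.pi_pos]

theorem hasExpGrowthOnStrips_inv_Gammaℝ :
    HasExpGrowthOnStrips fun s => (Complex.Gammaℝ s)⁻¹ := by
  refine ((HasExpGrowthOnStrips.ofReal_cpow Real.pi_pos).comp_div_two.mul
    hasExpGrowthOnStrips_inv_Gamma.comp_div_two).congr_of_im_ne_zero fun s _ => ?_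
  rw [Complex.Gammaℝ_def, mul_inv, ← Complex.cpow_neg, neg_div, neg_neg]

theorem hasExpGrowthOnStrips_twistedZetaMellin {N : ℕ} [NeZero N] {χ : DirichletCharacter ℂ N}
    (heven : χ.Even) (a ρ : ℝ) : HasExpGrowthOnStrips (twistedZetaMellin χ a ρ) := by
  have hN : (0 : ℝ) < (N : ℝ)⁻¹ := by
    have : (0 : ℝ) < N := by exact_mod_cast Nat.pos_of_ne_zero (NeZero.ne N)
    positivity
  have hsub : HasExpGrowthOnStrips fun s => s - 1 := by
    simpa [sub_eq_add_neg] using HasExpGrowthOnStrips.id.add (.const (-1))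
  have hL : HasExpGrowthOnStrips χ.completedLFunction := by
    refine ((HasExpGrowthOnStrips.ofReal_cpow hN).mul (.sum Finset.univ fun j _ =>
      (HasExpGrowthOnStrips.const (χ j)).mul
        (.completedHurwitzZetaEven (ZMod.toAddCircle j)))).congr_of_im_ne_zero fun s _ => ?_
    rw [DirichletCharacter.completedLFunction, ZMod.completedLFunction_def_even heven.to_fun,
      Complex.cpow_neg, Complex.ofReal_inv, Complex.ofReal_natCast, Complex.inv_cpow]
    rw [Complex.natCast_arg]
    exact Real.pi_pos.ne
  have hi := hasExpGrowthOnStrips_inv_Gamma.comp_add_div_two (ρ + 1)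
  refine ((((((HasExpGrowthOnStrips.const ((Real.Gamma (ρ + 1) : ℂ) / 2)).mul
    (HasExpGrowthOnStrips.ofReal_cpow Real.pi_pos).comp_div_two).mul
    (hsub.mul ((HasExpGrowthOnStrips.completedHurwitzZetaEven 0).mul
      hasExpGrowthOnStrips_inv_Gammaℝ))).mul
    ((HasExpGrowthOnStrips.completedCosZeta a).mul hasExpGrowthOnStrips_inv_Gammaℝ)).mul hL).mul
    hi).congr_of_im_ne_zero fun s hs => ?_
  have h0 : s ≠ 0 := fun h => by simp [h] at hs
  have h1 : s ≠ 1 := fun h => by simp [h] at hs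
  rw [twistedZetaMellin, LFunctionTrivChar₁_one_eq h1, riemannZeta_def_of_ne_zero h0,
    HurwitzZeta.cosZeta, Function.update_of_ne h0, HurwitzZeta.completedHurwitzZetaEven_zero]
  push_cast
  ring

theorem differentiable_twistedZetaMellin {N : ℕ} [NeZero N] {χ : DirichletCharacter ℂ N}
    (hχ : χ ≠ 1) {a : ℝ} (ha : (a : UnitAddCircle) ≠ 0) (ρ : ℝ) :
    Differentiable ℂ (twistedZetaMellin χ a ρ) := by
  have hπ : (π : ℂ) ≠ 0 := by exact_mod_cast Real.pi_ne_zero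
  have h1 : Differentiable ℂ fun s : ℂ => (π : ℂ) ^ (s / 2) := by
    intro s
    exact ((differentiableAt_id.div_const 2).const_cpow (Or.inl hπ))
  have h2 : Differentiable ℂ fun s : ℂ => (Complex.Gamma (ρ + 1 + s / 2))⁻¹ :=
    Complex.differentiable_one_div_Gamma.comp (by fun_prop)
  exact (((((h1.const_mul _)).mul
    (DirichletCharacter.differentiable_LFunctionTrivChar₁ 1)).mul
    (HurwitzZeta.differentiable_cosZeta_of_ne_zero ha)).mul
    (DirichletCharacter.differentiable_completedLFunction hχ)).mul h2

theorem twistedZetaMellin_eq_of_re_pos {N : ℕ} [NeZero N] {χ : DirichletCharacter ℂ N}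
    (heven : χ.Even) (a ρ : ℝ) {s : ℂ} (hs : 0 < s.re) :
    twistedZetaMellin χ a ρ s = (Real.Gamma (ρ + 1) : ℂ) / 2 *
      (Complex.Gamma (s / 2) * (Complex.Gamma (s / 2 + (ρ + 1)))⁻¹) *
      (DirichletCharacter.LFunctionTrivChar₁ 1 s * HurwitzZeta.cosZeta a s * χ.LFunction s) := by
  have hπ : (π : ℂ) ≠ 0 := by exact_mod_cast Real.pi_ne_zero
  rw [twistedZetaMellin, completedLFunction_even_eq heven hs, Complex.Gammaℝ_def, neg_div,
    Complex.cpow_neg, add_comm (ρ + 1 : ℂ)]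
  have : (π : ℂ) ^ (s / 2) ≠ 0 := by simp [Complex.cpow_eq_zero_iff, hπ]
  field_simp

theorem twistedZetaMellin_one {N : ℕ} [NeZero N] {χ : DirichletCharacter ℂ N}
    (heven : χ.Even) (a ρ : ℝ) :
    twistedZetaMellin χ a ρ 1 = ((Real.sqrt π * Real.Gamma (ρ + 1) : ℝ) : ℂ) /
      ((2 * Real.Gamma (ρ + 3 / 2) : ℝ) : ℂ) * (HurwitzZeta.cosZeta a 1 * χ.LFunction 1) := by
  rw [twistedZetaMellin_eq_of_re_pos heven a ρ (by simp), LFunctionTrivChar₁_one_one,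
    Complex.Gamma_one_half_eq, show (1 / 2 + (ρ + 1) : ℂ) = ((ρ + 3 / 2 : ℝ) : ℂ) by
      push_cast; ring, Complex.Gamma_ofReal]
  rw [Real.sqrt_eq_rpow]
  push_cast [Complex.ofReal_cpow Real.pi_pos.le]
  rw [div_eq_mul_inv _ (2 * _ : ℂ), mul_inv]
  ring

/-- The Dirichlet coefficients of `ζ(s) · ∑ cos(2πna) n⁻ˢ · L(s, χ)`. -/
noncomputable def twistedDivisorSum {N : ℕ} (χ : DirichletCharacter ℂ N) (a : ℝ) (n : ℕ) : ℂ :=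
  ∑ r ∈ n.divisors, divisorSumChar χ (n / r) * (Real.cos (2 * π * a * r) : ℂ)

open scoped LSeries.notation in
theorem lSeriesHasSum_twistedDivisorSum {N : ℕ} [NeZero N] (χ : DirichletCharacter ℂ N) (a : ℝ)
    {s : ℂ} (hs : 1 < s.re) :
    LSeriesHasSum (twistedDivisorSum χ a) s
      (riemannZeta s * HurwitzZeta.cosZeta a s * χ.LFunction s) := by
  have h1 : divisorSumChar χ = (fun n : ℕ => χ n) ⍟ 1 := by
    rw [LSeries.convolution_def]
    ext n
    rw [Nat.sum_divisorsAntidiagonal fun x y => χ (x : ZMod N) * (1 : ℕ → ℂ) y]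
    simp [divisorSumChar]
  have h2 : twistedDivisorSum χ a =
      (fun n : ℕ => (Real.cos (2 * π * a * n) : ℂ)) ⍟ divisorSumChar χ := by
    rw [LSeries.convolution_def]
    ext n
    rw [Nat.sum_divisorsAntidiagonal fun x y =>
      (Real.cos (2 * π * a * x) : ℂ) * divisorSumChar χ y]
    exact Finset.sum_congr rfl fun r _ => mul_comm _ _
  rw [h2, h1, mul_comm (riemannZeta s), mul_assoc (HurwitzZeta.cosZeta a s),
    mul_comm (riemannZeta s),
    χ.LFunction_eq_LSeries hs]
  exact (HurwitzZeta.LSeriesHasSum_cos a hs).convolution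
    ((χ.LSeriesSummable_of_one_lt_re hs).LSeriesHasSum.convolution (LSeriesHasSum_one hs))

theorem twistedZetaMellin_div_eq_LSeries {N : ℕ} [NeZero N] {χ : DirichletCharacter ℂ N}
    (heven : χ.Even) (a ρ : ℝ) {s : ℂ} (hs : 1 < s.re) :
    twistedZetaMellin χ a ρ s / (s - 1) = (Real.Gamma (ρ + 1) : ℂ) / 2 *
      (Complex.Gamma (s / 2) * (Complex.Gamma (s / 2 + (ρ + 1)))⁻¹) *
      LSeries (twistedDivisorSum χ a) s := by
  have h1 : s ≠ 1 := fun h => by simp [h] at hs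
  rw [twistedZetaMellin_eq_of_re_pos heven a ρ (by linarith), LFunctionTrivChar₁_one_eq h1,
    (lSeriesHasSum_twistedDivisorSum χ a hs).LSeries_eq]
  have := sub_ne_zero.mpr h1
  field_simp

theorem continuous_Gamma_div_Gamma_two (ρ : ℝ) :
    Continuous fun t : ℝ => Complex.Gamma ((2 + t * Complex.I) / 2) *
      (Complex.Gamma ((2 + t * Complex.I) / 2 + (ρ + 1)))⁻¹ := by
  refine .mul ?_ ?_
  · refine continuous_iff_continuousAt.mpr fun t =>
      (Complex.differentiableAt_Gamma _ fun m h => ?_).continuousAt.comp (by fun_prop)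
    have := congrArg Complex.re h
    simp at this
    linarith [m.cast_nonneg (α := ℝ)]
  · exact Complex.differentiable_one_div_Gamma.continuous.comp (by fun_prop)

theorem exists_norm_Gamma_div_Gamma_two_le (ρ : ℝ) :
    ∃ C, ∀ t : ℝ, ‖Complex.Gamma ((2 + t * Complex.I) / 2) *
      (Complex.Gamma ((2 + t * Complex.I) / 2 + (ρ + 1)))⁻¹‖ ≤ C * (1 + |t|) ^ (-(ρ + 1)) := by
  obtain ⟨C₀, hC₀⟩ := exists_norm_Gamma_div_Gamma_le 1 (ρ + 2)
  refine exists_norm_le_one_add_abs_rpow (continuous_Gamma_div_Gamma_two ρ)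
    (C := C₀ * (1 / 2) ^ (-(ρ + 1))) (fun t => ?_) ?_
  · rw [← Complex.norm_conj]
    simp only [map_mul, map_inv₀, ← Complex.Gamma_conj]
    have h2 : (starRingEnd ℂ) 2 = 2 := Complex.conj_ofNat 2
    simp [h2]
  · filter_upwards [(tendsto_id.atTop_div_const (zero_lt_two' ℝ)).eventually hC₀,
      eventually_gt_atTop 0] with t ht ht0
    rw [mul_assoc, ← Real.mul_rpow (by norm_num) ht0.le]
    have e1 : (2 + t * Complex.I) / 2 = ((1 : ℝ) : ℂ) + ((t / 2 : ℝ) : ℂ) * Complex.I := by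
      push_cast; ring
    have e2 : (2 + t * Complex.I) / 2 + (ρ + 1) =
        ((ρ + 2 : ℝ) : ℂ) + ((t / 2 : ℝ) : ℂ) * Complex.I := by
      push_cast; ring
    rw [e2, e1, show -(ρ + 1) = 1 - (ρ + 2) by ring, one_div_mul_eq_div]
    exact ht

theorem norm_term_two_add_mul_I (f : ℕ → ℂ) (n : ℕ) (t : ℝ) :
    ‖LSeries.term f (2 + t * Complex.I) n‖ = ‖LSeries.term f 2 n‖ := by
  simp only [LSeries.norm_term_eq]
  simp

theorem exists_norm_twistedZetaMellin_right {N : ℕ} [NeZero N] {χ : DirichletCharacter ℂ N}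
    (heven : χ.Even) (a ρ : ℝ) :
    ∃ C, ∀ t : ℝ, ‖twistedZetaMellin χ a ρ (2 + t * Complex.I) / (2 + t * Complex.I - 1)‖ ≤
      C * (1 + |t|) ^ (-(ρ + 1)) := by
  obtain ⟨C₁, hC₁⟩ := exists_norm_Gamma_div_Gamma_two_le ρ
  have hS := (lSeriesHasSum_twistedDivisorSum χ a (s := 2) (by simp)).LSeriesSummable.norm
  have hL : ∀ t : ℝ, ‖LSeries (twistedDivisorSum χ a) (2 + t * Complex.I)‖ ≤
      ∑' n, ‖LSeries.term (twistedDivisorSum χ a) 2 n‖ := fun t =>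
    tsum_of_norm_bounded hS.hasSum fun n => (norm_term_two_add_mul_I _ n t).le
  refine ⟨‖(Real.Gamma (ρ + 1) : ℂ) / 2‖ * C₁ *
    ∑' n, ‖LSeries.term (twistedDivisorSum χ a) 2 n‖, fun t => ?_⟩
  rw [twistedZetaMellin_div_eq_LSeries heven a ρ (by simp), norm_mul, norm_mul]
  have h1 := mul_le_mul_of_nonneg_left (hC₁ t) (norm_nonneg ((Real.Gamma (ρ + 1) : ℂ) / 2))
  refine (mul_le_mul h1 (hL t) (norm_nonneg _) ((by positivity : (0 : ℝ) ≤ _).trans h1)).trans_eq ?_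
  ring

theorem exists_norm_twistedZetaMellin_strip {N : ℕ} [NeZero N] {χ : DirichletCharacter ℂ N}
    (heven : χ.Even) (hprim : χ.IsPrimitive) (hχ : χ ≠ 1) {a : ℝ} (ha : (a : UnitAddCircle) ≠ 0)
    {ρ : ℝ} (hρ : 1 < ρ) :
    ∃ C, ∀ s : ℂ, (1 - ρ) / 3 ≤ s.re → s.re ≤ 2 →
      ‖twistedZetaMellin χ a ρ s‖ ^ 2 ≤ C * (1 + |s.im|) := by
  obtain ⟨C₁, h₁⟩ := exists_norm_twistedZetaMellin_left heven hprim a hρ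
  obtain ⟨C₂, h₂⟩ := exists_norm_twistedZetaMellin_right heven a ρ
  obtain ⟨C₃, B, T, h₃⟩ := hasExpGrowthOnStrips_twistedZetaMellin heven a ρ ((1 - ρ) / 3) 2
  have hd := differentiable_twistedZetaMellin hχ ha ρ
  set σ := (1 - ρ) / 3 with hσ
  have hσ0 : σ < 0 := by rw [hσ]; linarith
  set D : ℂ → ℂ := fun s => s + ((1 - σ : ℝ) : ℂ) with hD
  have hDre : ∀ s : ℂ, σ ≤ s.re → 1 ≤ (D s).re := fun s hs => by simp [hD]; linarith
  have hD1 : ∀ s : ℂ, σ ≤ s.re → 1 ≤ ‖D s‖ := fun s hs =>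
    (hDre s hs).trans (Complex.re_le_norm _)
  have hD0 : ∀ s : ℂ, σ ≤ s.re → D s ≠ 0 := fun s hs =>
    norm_pos_iff.mp (one_pos.trans_le (hD1 s hs))
  have hDim : ∀ s : ℂ, |s.im| ≤ ‖D s‖ := fun s => by
    have := Complex.abs_im_le_norm (D s)
    simpa [hD] using this
  have key : ∀ s : ℂ, σ ≤ s.re → s.re ≤ 2 →
      ‖twistedZetaMellin χ a ρ s ^ 2 / D s‖ ≤ max (2 * C₁ ^ 2 * (1 - σ) ^ 2) (C₂ ^ 2) := by
    intro s h1 h2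
    refine PhragmenLindelof.vertical_strip (a := σ) (b := 2)
      (f := fun s => twistedZetaMellin χ a ρ s ^ 2 / D s) ?_ ?_ ?_ ?_ h1 h2
    · refine DifferentiableOn.diffContOnCl fun z hz => ?_
      have hz : σ ≤ z.re := by
        have : closure (Complex.re ⁻¹' Set.Ioo σ 2) ⊆ {z | σ ≤ z.re} :=
          closure_minimal (fun z hz => hz.1.le) (isClosed_le continuous_const Complex.continuous_re)
        exact this hz
      exact (((hd z).pow 2).div (by simp only [hD]; fun_prop) (hD0 z hz)).differentiableWithinAt
    · have hc : 0 < π / (2 - σ) := div_pos Real.pi_pos (by linarith)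
      set c := π / (2 - σ) / 2 with hc'
      have hc0 : 0 < c := half_pos hc
      refine ⟨c, half_lt_self hc, 2 * |B| / c, IsBigO.of_bound (C₃ ^ 2) ?_⟩
      refine eventually_inf_principal.mpr
        (((eventually_ge_atTop T).comap (_root_.abs ∘ Complex.im)).mono fun z hz hzs => ?_)
      have i1 := h₃ z hzs.1.le hzs.2.le hz
      rw [norm_div, norm_pow, Real.norm_eq_abs, Real.abs_exp]
      refine (div_le_self (by positivity) (hD1 z hzs.1.le)).trans ?_
      calc _ ≤ (C₃ * Real.exp (B * |z.im|)) ^ 2 := by gcongr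
        _ = C₃ ^ 2 * Real.exp (2 * (B * |z.im|)) := by
          rw [mul_pow, ← Real.exp_nat_mul]; norm_num
        _ ≤ _ := by
          refine mul_le_mul_of_nonneg_left (Real.exp_le_exp.mpr ?_) (sq_nonneg _)
          have i2 := Real.add_one_le_exp (c * |z.im|)
          rw [div_mul_eq_mul_div, le_div_iff₀ hc0]
          have i3 : B * |z.im| ≤ |B| * |z.im| := by gcongr; exact le_abs_self B
          nlinarith [abs_nonneg B, mul_le_mul_of_nonneg_left i3 hc0.le,
            mul_le_mul_of_nonneg_left i2 (abs_nonneg B)]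
    · intro z hz
      refine le_trans ?_ (le_max_left _ _)
      have i1 := h₁ z.im
      have ez : ((σ : ℝ) : ℂ) + z.im * Complex.I = z := by rw [← hz, Complex.re_add_im]
      have hz1 : z - 1 ≠ 0 := fun h => by
        have := congrArg Complex.re h
        simp [hz] at this; linarith
      rw [ez, norm_div, div_le_iff₀ (norm_pos_iff.mpr hz1)] at i1
      have i2 : ‖z - 1‖ ≤ (1 - σ) * (1 + |z.im|) := by
        refine (Complex.norm_le_abs_re_add_abs_im _).trans ?_
        simp only [Complex.sub_re, Complex.one_re, Complex.sub_im, Complex.one_im, sub_zero, hz]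
        rw [abs_of_neg (by linarith)]
        nlinarith [abs_nonneg z.im]
      rw [norm_div, norm_pow, div_le_iff₀ (one_pos.trans_le (hD1 z hz.ge))]
      have i3 : 1 + |z.im| ≤ 2 * ‖D z‖ := by linarith [hDim z, hD1 z hz.ge]
      have hp : (0 : ℝ) < 1 + |z.im| := by positivity
      have e4 : ((1 + |z.im|) ^ (-(1 / 2) : ℝ)) ^ 2 = (1 + |z.im|)⁻¹ := by
        rw [← Real.rpow_natCast, ← Real.rpow_mul hp.le, ← Real.rpow_neg_one]; norm_num
      calc ‖twistedZetaMellin χ a ρ z‖ ^ 2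
          ≤ (C₁ * (1 + |z.im|) ^ (-(1 / 2) : ℝ) * ‖z - 1‖) ^ 2 := by gcongr
        _ = C₁ ^ 2 * (1 + |z.im|)⁻¹ * ‖z - 1‖ ^ 2 := by rw [mul_pow, mul_pow, e4]
        _ ≤ C₁ ^ 2 * (1 + |z.im|)⁻¹ * ((1 - σ) * (1 + |z.im|)) ^ 2 := by gcongr
        _ = C₁ ^ 2 * (1 - σ) ^ 2 * (1 + |z.im|) := by field_simp
        _ ≤ C₁ ^ 2 * (1 - σ) ^ 2 * (2 * ‖D z‖) := by gcongr
        _ = _ := by ring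
    · intro z hz
      refine le_trans ?_ (le_max_right _ _)
      have i1 := h₂ z.im
      have ez : (2 : ℂ) + z.im * Complex.I = z := by
        conv_rhs => rw [← Complex.re_add_im z, hz]
        simp
      have hz1 : z - 1 ≠ 0 := fun h => by
        have := congrArg Complex.re h
        simp [hz] at this; linarith
      rw [ez, norm_div, div_le_iff₀ (norm_pos_iff.mpr hz1)] at i1
      have i2 : ‖z - 1‖ ≤ 1 + |z.im| := by
        refine (Complex.norm_le_abs_re_add_abs_im _).trans_eq ?_
        simp only [Complex.sub_re, Complex.one_re, Complex.sub_im, Complex.one_im, sub_zero, hz]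
        norm_num
      have hp : (1 : ℝ) ≤ 1 + |z.im| := by simp
      have hC : 0 ≤ C₂ := by
        have := (norm_nonneg _).trans (h₂ 0)
        simpa using this
      rw [norm_div, norm_pow]
      refine (div_le_self (by positivity) (hD1 z (by rw [hz]; linarith))).trans ?_
      gcongr
      calc _ ≤ _ := i1
        _ ≤ C₂ * (1 + |z.im|) ^ (-1 : ℝ) * (1 + |z.im|) := by
          gcongr
          linarith
        _ = C₂ := by rw [Real.rpow_neg_one]; field_simp
  refine ⟨max (2 * C₁ ^ 2 * (1 - σ) ^ 2) (C₂ ^ 2) * (3 - σ), fun s h1 h2 => ?_⟩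
  have := key s h1 h2
  rw [norm_div, norm_pow, div_le_iff₀ (one_pos.trans_le (hD1 s h1))] at this
  refine this.trans ?_
  rw [mul_assoc (max _ _)]
  have h0 : 0 ≤ max (2 * C₁ ^ 2 * (1 - σ) ^ 2) (C₂ ^ 2) := le_max_of_le_right (sq_nonneg _)
  gcongr
  refine (Complex.norm_le_abs_re_add_abs_im _).trans ?_
  rw [abs_of_pos (one_pos.trans_le (hDre s h1))]
  simp only [hD, Complex.add_re, Complex.ofReal_re, Complex.add_im, Complex.ofReal_im, add_zero]
  nlinarith [abs_nonneg s.im]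

theorem mellin_one_sub_rpow {ρ : ℝ} (hρ : 0 < ρ) (s : ℂ) :
    mellin (fun v : ℝ => ((max (1 - v) 0 ^ ρ : ℝ) : ℂ)) s = Complex.betaIntegral s (ρ + 1) := by
  rw [mellin, Complex.betaIntegral, intervalIntegral.integral_of_le zero_le_one,
    ← Set.Ioc_union_Ioi_eq_Ioi (zero_le_one' ℝ),
    MeasureTheory.setIntegral_eq_of_subset_of_forall_sdiff_eq_zero
      (t := Set.Ioc (0 : ℝ) 1 ∪ Set.Ioi 1)
      (s := Set.Ioc (0 : ℝ) 1)
      (measurableSet_Ioc.union measurableSet_Ioi) Set.subset_union_left]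
  · refine MeasureTheory.setIntegral_congr_fun measurableSet_Ioc fun v hv => ?_
    have : 0 ≤ 1 - v := by linarith [hv.2]
    simp only [max_eq_left this, Complex.ofReal_cpow this, smul_eq_mul]
    push_cast
    rw [add_sub_cancel_right]
  · rintro v ⟨hv | hv, hv'⟩
    · exact absurd hv hv'
    · have : 1 - v ≤ 0 := by linarith [Set.mem_Ioi.mp hv]
      simp [max_eq_right this, Real.zero_rpow hρ.ne']

theorem mellin_one_sub_sq_rpow {ρ : ℝ} (hρ : 0 < ρ) {s : ℂ} (hs : 0 < s.re) :
    mellin (fun u : ℝ => ((max (1 - u ^ 2) 0 ^ ρ : ℝ) : ℂ)) s = (Real.Gamma (ρ + 1) : ℂ) / 2 *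
      (Complex.Gamma (s / 2) * (Complex.Gamma (s / 2 + (ρ + 1)))⁻¹) := by
  have h := mellin_comp_rpow (fun v : ℝ => ((max (1 - v) 0 ^ ρ : ℝ) : ℂ)) s 2
  have hs2 : 0 < (s / 2).re := by simpa using hs
  have h1 : ((ρ : ℂ) + 1) = ((ρ + 1 : ℝ) : ℂ) := by push_cast; rfl
  have hb := Complex.Gamma_mul_Gamma_eq_betaIntegral hs2 (t := ρ + 1)
    (by rw [h1, Complex.ofReal_re]; linarith)
  have hne : Complex.Gamma (s / 2 + (ρ + 1)) ≠ 0 :=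
    Complex.Gamma_ne_zero_of_re_pos (by rw [h1, Complex.add_re, Complex.ofReal_re]; linarith)
  simp only [Real.rpow_two] at h
  rw [h, show s / ((2 : ℝ) : ℂ) = s / 2 by norm_num, mellin_one_sub_rpow hρ,
    eq_div_of_mul_eq hne ((mul_comm _ _).trans hb.symm)]
  nth_rewrite 1 [h1]
  rw [Complex.Gamma_ofReal, Complex.real_smul]
  push_cast
  rw [abs_of_pos (by norm_num : (0 : ℝ) < 2)]
  push_cast
  ring

theorem continuous_one_sub_sq_rpow {ρ : ℝ} (hρ : 0 < ρ) :
    Continuous fun u : ℝ => ((max (1 - u ^ 2) 0 ^ ρ : ℝ) : ℂ) :=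
  Complex.continuous_ofReal.comp
    ((by fun_prop : Continuous fun u : ℝ => max (1 - u ^ 2) 0).rpow_const fun _ => Or.inr hρ.le)

theorem integrable_one_add_abs_rpow {ρ : ℝ} (hρ : 0 < ρ) :
    MeasureTheory.Integrable fun t : ℝ => (1 + |t|) ^ (-(ρ + 1)) := by
  simpa using integrable_one_add_norm (E := ℝ) (μ := MeasureTheory.volume) (r := ρ + 1)
    (by simpa using hρ)

theorem mellinInv_one_sub_sq_rpow {ρ : ℝ} (hρ : 0 < ρ) {u : ℝ} (hu : 0 < u) :
    ((max (1 - u ^ 2) 0 ^ ρ : ℝ) : ℂ) = (1 / (2 * π) : ℂ) * ∫ t : ℝ,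
      (u : ℂ) ^ (-(2 + t * Complex.I)) * ((Real.Gamma (ρ + 1) : ℂ) / 2 *
      (Complex.Gamma ((2 + t * Complex.I) / 2) *
        (Complex.Gamma ((2 + t * Complex.I) / 2 + (ρ + 1)))⁻¹)) := by
  have hre : ∀ t : ℝ, 0 < (2 + t * Complex.I).re := fun t => by simp
  have hc := continuous_one_sub_sq_rpow hρ
  obtain ⟨C, hC⟩ := exists_norm_Gamma_div_Gamma_two_le ρ
  have := mellinInv_mellin_eq 2 (fun u : ℝ => ((max (1 - u ^ 2) 0 ^ ρ : ℝ) : ℂ)) hu ?_ ?_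
    hc.continuousAt
  · rw [← this, mellinInv, Complex.real_smul]
    push_cast
    simp only [mellin_one_sub_sq_rpow hρ (hre _), smul_eq_mul]
  · refine mellinConvergent_of_isBigO_rpow (a := 3) (b := 0)
      (hc.locallyIntegrable.locallyIntegrableOn _) ?_ (by norm_num) ?_ (by norm_num)
    · refine EventuallyEq.trans_isBigO (f₂ := fun _ => 0) ?_ (isBigO_zero _ _)
      filter_upwards [eventually_ge_atTop 1] with v hv
      rw [max_eq_right (by nlinarith), Real.zero_rpow hρ.ne', Complex.ofReal_zero]
    · simp only [neg_zero, Real.rpow_zero]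
      exact (hc.tendsto 0).isBigO_one ℝ |>.mono nhdsWithin_le_nhds
  · rw [Complex.VerticalIntegrable]
    push_cast
    simp only [mellin_one_sub_sq_rpow hρ (hre _)]
    refine .const_mul ?_ _
    exact ((integrable_one_add_abs_rpow hρ).const_mul C).mono'
      (continuous_Gamma_div_Gamma_two ρ).aestronglyMeasurable (Eventually.of_forall hC)

theorem sum_twistedDivisorSum_eq_integral {N : ℕ} [NeZero N] {χ : DirichletCharacter ℂ N}
    (heven : χ.Even) (a : ℝ) {ρ : ℝ} (hρ : 0 < ρ) {x : ℝ} (hx : 0 < x) :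
    ∑ n ∈ Finset.Icc 1 ⌊x⌋₊, (((x ^ 2 - (n : ℝ) ^ 2) ^ ρ : ℝ) : ℂ) * twistedDivisorSum χ a n =
      ((x ^ (2 * ρ) : ℝ) : ℂ) * (1 / (2 * π) * ∫ t : ℝ,
        twistedZetaMellin χ a ρ (2 + t * Complex.I) / (2 + t * Complex.I - 1) *
          (x : ℂ) ^ (2 + t * Complex.I)) := by
  set M : ℝ → ℂ := fun t => (Real.Gamma (ρ + 1) : ℂ) / 2 *
    (Complex.Gamma ((2 + t * Complex.I) / 2) *
      (Complex.Gamma ((2 + t * Complex.I) / 2 + (ρ + 1)))⁻¹) with hM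
  set b := twistedDivisorSum χ a with hb
  have hx' : (x : ℂ) ≠ 0 := by exact_mod_cast hx.ne'
  have hMc : Continuous M := continuous_const.mul (continuous_Gamma_div_Gamma_two ρ)
  have hMi : MeasureTheory.Integrable M := by
    obtain ⟨C, hC⟩ := exists_norm_Gamma_div_Gamma_two_le ρ
    exact (((integrable_one_add_abs_rpow hρ).const_mul C).mono'
      (continuous_Gamma_div_Gamma_two ρ).aestronglyMeasurable (Eventually.of_forall hC)).const_mul _
  have hterm : ∀ (n : ℕ) (t : ℝ), LSeries.term b (2 + t * Complex.I) n *
      ((x : ℂ) ^ (2 + t * Complex.I) * M t) =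
      b n * (if n = 0 then 0 else 1) * (((n / x : ℝ) : ℂ) ^ (-(2 + t * Complex.I)) * M t) := by
    intro n t
    rcases eq_or_ne n 0 with rfl | hn
    · simp
    · have hn' : (n : ℂ) ≠ 0 := by exact_mod_cast hn
      rw [LSeries.term_of_ne_zero hn, if_neg hn, mul_one, div_eq_mul_inv (n : ℝ) x,
        Complex.ofReal_mul,
        Complex.mul_cpow_ofReal_nonneg n.cast_nonneg (inv_nonneg.mpr hx.le), Complex.ofReal_inv,
        Complex.ofReal_natCast, Complex.cpow_neg, Complex.cpow_neg,
        Complex.inv_cpow _ _ (by rw [Complex.arg_ofReal_of_nonneg hx.le]; exact Real.pi_pos.ne),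
        inv_inv]
      ring
  have hnorm : ∀ (n : ℕ) (t : ℝ), ‖LSeries.term b (2 + t * Complex.I) n *
      ((x : ℂ) ^ (2 + t * Complex.I) * M t)‖ = ‖LSeries.term b 2 n‖ * (x ^ (2 : ℝ) * ‖M t‖) := by
    intro n t
    rw [norm_mul, norm_mul, norm_term_two_add_mul_I, Complex.norm_cpow_eq_rpow_re_of_pos hx]
    simp
  have hcts : ∀ n : ℕ, Continuous fun t : ℝ => LSeries.term b (2 + t * Complex.I) n *
      ((x : ℂ) ^ (2 + t * Complex.I) * M t) := by
    intro n
    refine .mul ?_ (.mul (.const_cpow (by fun_prop) (Or.inl hx')) hMc)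
    rcases eq_or_ne n 0 with rfl | hn
    · simpa using continuous_const
    · simp only [LSeries.term_of_ne_zero hn]
      refine continuous_const.div (.const_cpow (by fun_prop) (Or.inl (by exact_mod_cast hn)))
        fun t => ?_
      simp [Complex.cpow_eq_zero_iff, hn]
  have hint : ∀ n : ℕ, MeasureTheory.Integrable fun t : ℝ => LSeries.term b (2 + t * Complex.I) n *
      ((x : ℂ) ^ (2 + t * Complex.I) * M t) := fun n =>
    ((hMi.norm.const_mul _).const_mul _).mono' (hcts n).aestronglyMeasurable
      (Eventually.of_forall fun t => (hnorm n t).le)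
  have hsum := MeasureTheory.hasSum_integral_of_summable_integral_norm hint (by
    simp only [hnorm, MeasureTheory.integral_const_mul]
    exact (lSeriesHasSum_twistedDivisorSum χ a (s := 2) (by simp)).LSeriesSummable.norm.mul_right _)
  have hL : ∀ t : ℝ, ∑' n, LSeries.term b (2 + t * Complex.I) n *
      ((x : ℂ) ^ (2 + t * Complex.I) * M t) =
      twistedZetaMellin χ a ρ (2 + t * Complex.I) / (2 + t * Complex.I - 1) *
          (x : ℂ) ^ (2 + t * Complex.I) := by
    intro t
    rw [tsum_mul_right, twistedZetaMellin_div_eq_LSeries heven a ρ (by simp), ← LSeries, hM]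
    ring
  simp only [hL] at hsum
  have hval : ∀ n : ℕ, (∫ t : ℝ, LSeries.term b (2 + t * Complex.I) n *
      ((x : ℂ) ^ (2 + t * Complex.I) * M t)) =
      2 * π * (b n * (if n = 0 then 0 else 1) * ((max (1 - (n / x) ^ 2) 0 ^ ρ : ℝ) : ℂ)) := by
    intro n
    simp only [hterm, MeasureTheory.integral_const_mul]
    rcases eq_or_ne n 0 with rfl | hn
    · simp
    · have hn0 : (0 : ℝ) < n := by exact_mod_cast Nat.pos_of_ne_zero hn
      rw [mellinInv_one_sub_sq_rpow hρ (div_pos hn0 hx), mul_left_comm (2 * π : ℂ),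
        ← mul_assoc (2 * π : ℂ), mul_one_div_cancel (by simp), one_mul]
  simp only [hval] at hsum
  have hfin := hsum.unique (hasSum_sum_of_ne_finset_zero (s := Finset.Icc 1 ⌊x⌋₊) fun n hn => ?_)
  · rw [hfin, ← Finset.mul_sum, ← mul_assoc (1 / (2 * π : ℂ)), one_div_mul_cancel (by
      exact_mod_cast Real.two_pi_pos.ne'), one_mul, Finset.mul_sum]
    refine Finset.sum_congr rfl fun n hn => ?_
    obtain ⟨h1, h2⟩ := Finset.mem_Icc.mp hn
    have hnx : (n : ℝ) ≤ x := (Nat.le_floor_iff hx.le).mp h2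
    have h3 : x ^ 2 - (n : ℝ) ^ 2 = x ^ 2 * max (1 - (n / x) ^ 2) 0 := by
      rw [max_eq_left (by
        rw [sub_nonneg]
        exact pow_le_one₀ (by positivity) ((div_le_one hx).mpr hnx))]
      field_simp
    rw [h3, Real.mul_rpow (by positivity) (le_max_right _ _), ← Real.rpow_natCast x 2,
      ← Real.rpow_mul hx.le, if_neg (by omega)]
    push_cast
    ring
  · rcases eq_or_ne n 0 with rfl | hn0
    · simp
    · have : x < n := by
        rw [Finset.mem_Icc, not_and, not_le] at hn
        exact (Nat.floor_lt hx.le).mp (hn (Nat.pos_of_ne_zero hn0))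
      rw [max_eq_right (by
        rw [sub_nonpos]
        exact one_le_pow₀ ((one_le_div hx).mpr this.le)), Real.zero_rpow hρ.ne']
      simp

theorem tendsto_integral_inv_add_mul_I {a : ℝ} (ha : a ≠ 0) :
    Tendsto (fun T : ℝ => ∫ t in (-T)..T, ((a : ℂ) + t * Complex.I)⁻¹) atTop
      (𝓝 (((SignType.sign a : ℝ) * π : ℝ) : ℂ)) := by
  have hval : ∀ T : ℝ, ∫ t in (-T)..T, ((a : ℂ) + t * Complex.I)⁻¹ =
      ((2 * Real.arctan (T / a) : ℝ) : ℂ) := by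
    intro T
    have h0 : ∀ t : ℝ, (a : ℂ) + t * Complex.I ≠ 0 := fun t h =>
      ha (by simpa using congrArg Complex.re h)
    have hd : ∀ t : ℝ, HasDerivAt (fun t : ℝ => ((Real.arctan (t / a) : ℝ) : ℂ) -
        Complex.I * ((Real.log (a ^ 2 + t ^ 2) / 2 : ℝ) : ℂ)) ((a : ℂ) + t * Complex.I)⁻¹ t := by
      intro t
      have hp : a ^ 2 + t ^ 2 ≠ 0 := by positivity
      have h1 : HasDerivAt (fun t : ℝ => Real.arctan (t / a)) (a / (a ^ 2 + t ^ 2)) t := by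
        refine ((hasDerivAt_id' t).div_const a).arctan.congr_deriv ?_
        field_simp
      have h2 : HasDerivAt (fun t : ℝ => Real.log (a ^ 2 + t ^ 2) / 2) (t / (a ^ 2 + t ^ 2)) t := by
        refine ((((hasDerivAt_id' t).fun_pow 2).const_add (a ^ 2)).log hp |>.div_const 2)
          |>.congr_deriv ?_
        field_simp
        norm_num
        ring
      refine (h1.ofReal_comp.sub (h2.ofReal_comp.const_mul Complex.I)).congr_deriv ?_
      have hp' : (a : ℂ) ^ 2 + (t : ℂ) ^ 2 ≠ 0 := by exact_mod_cast hp
      push_cast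
      refine eq_inv_of_mul_eq_one_left ?_
      field_simp
      linear_combination -(t : ℂ) ^ 2 * Complex.I_sq
    rw [intervalIntegral.integral_eq_sub_of_hasDerivAt (fun t _ => hd t)
      ((Continuous.inv₀ (by fun_prop) h0).intervalIntegrable _ _), neg_div, Real.arctan_neg]
    push_cast; ring_nf
  simp only [hval]
  refine (Complex.continuous_ofReal.tendsto _).comp ?_
  have hpi : ((SignType.sign a : ℝ) * π : ℝ) = 2 * ((SignType.sign a : ℝ) * (π / 2)) := by ring
  rw [hpi]
  refine Tendsto.const_mul 2 ?_
  rcases ha.lt_or_gt with h | h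
  · rw [sign_neg h]
    simpa [Function.comp_def, div_eq_mul_inv] using
      (Real.tendsto_arctan_atBot.mono_right nhdsWithin_le_nhds).comp
      (tendsto_id.atTop_mul_const_of_neg (inv_lt_zero.mpr h))
  · rw [sign_pos h]
    simpa [Function.comp_def, div_eq_mul_inv] using
      (Real.tendsto_arctan_atTop.mono_right nhdsWithin_le_nhds).comp
      (tendsto_id.atTop_mul_const (inv_pos.mpr h))

theorem tendsto_vertical_integral_sub {g : ℂ → ℂ} (hg : Differentiable ℂ g) {α β C : ℝ}
    (hα : α < 1) (hβ : 1 < β)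
    (hC : ∀ s : ℂ, α ≤ s.re → s.re ≤ β → ‖g s‖ ^ 2 ≤ C * (1 + |s.im|)) :
    Tendsto (fun T : ℝ => (∫ t in (-T)..T, g (β + t * Complex.I) / (β + t * Complex.I - 1)) -
      ∫ t in (-T)..T, g (α + t * Complex.I) / (α + t * Complex.I - 1)) atTop
      (𝓝 (2 * π * g 1)) := by
  have hd : Differentiable ℂ (dslope g 1) := by
    rw [← differentiableOn_univ, Complex.differentiableOn_dslope univ_mem]
    exact hg.differentiableOn
  have hds : ∀ s : ℂ, s ≠ 1 → dslope g 1 s = (g s - g 1) / (s - 1) := fun s hs => by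
    rw [dslope_of_ne _ hs, slope_def_field]
  -- horizontal sides
  have hor : ∀ ε : ℝ, |ε| = 1 → Tendsto (fun T : ℝ => ∫ y in α..β,
      dslope g 1 (y + ((ε * T : ℝ) : ℂ) * Complex.I)) atTop (𝓝 0) := by
    intro ε hε
    have hlim : Tendsto (fun T : ℝ => (Real.sqrt (C * (1 + T)) + ‖g 1‖) / T * (β - α)) atTop
        (𝓝 0) := by
      have h1 : Tendsto (fun T : ℝ => T⁻¹) atTop (𝓝 0) := tendsto_inv_atTop_zero
      have h2 : Tendsto (fun T : ℝ => (Real.sqrt (C * (T⁻¹ ^ 2 + T⁻¹)) + ‖g 1‖ * T⁻¹) * (β - α))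
          atTop (𝓝 ((Real.sqrt (C * (0 ^ 2 + 0)) + ‖g 1‖ * 0) * (β - α))) :=
        ((((h1.pow 2).add h1).const_mul C).sqrt.add (h1.const_mul _)).mul_const _
      rw [show (Real.sqrt (C * (0 ^ 2 + 0)) + ‖g 1‖ * 0) * (β - α) = 0 by simp] at h2
      refine h2.congr' ?_
      filter_upwards [eventually_gt_atTop 0] with T hT
      have : Real.sqrt (C * (T⁻¹ ^ 2 + T⁻¹)) = Real.sqrt (C * (1 + T)) / T := by
        rw [show C * (T⁻¹ ^ 2 + T⁻¹) = C * (1 + T) / T ^ 2 by field_simp,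
          Real.sqrt_div' _ (sq_nonneg T), Real.sqrt_sq hT.le]
      rw [this]
      ring
    refine squeeze_zero_norm' ?_ hlim
    filter_upwards [eventually_gt_atTop 0] with T hT
    rw [← abs_of_pos (by linarith : 0 < β - α)]
    refine intervalIntegral.norm_integral_le_of_norm_le_const fun y hy => ?_
    rw [Set.uIoc_of_le (by linarith)] at hy
    have him : |(y + ((ε * T : ℝ) : ℂ) * Complex.I).im| = T := by
      simp [abs_mul, hε, abs_of_pos hT]
    have hT' : T ≤ ‖y + ((ε * T : ℝ) : ℂ) * Complex.I - 1‖ := by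
      have := Complex.abs_im_le_norm (y + ((ε * T : ℝ) : ℂ) * Complex.I - 1)
      rwa [Complex.sub_im, Complex.one_im, sub_zero, him] at this
    have h1 : (y + ((ε * T : ℝ) : ℂ) * Complex.I) ≠ 1 := fun h => by
      rw [h, sub_self, norm_zero] at hT'
      linarith
    have h2 := hC (y + ((ε * T : ℝ) : ℂ) * Complex.I) (by simpa using hy.1.le)
      (by simpa using hy.2)
    rw [him] at h2
    rw [hds _ h1, norm_div]
    gcongr
    exact (norm_sub_le _ _).trans (by gcongr; exact Real.le_sqrt_of_sq_le h2)
  have hrect : ∀ T : ℝ, (∫ t in (-T)..T, dslope g 1 (β + t * Complex.I)) -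
      (∫ t in (-T)..T, dslope g 1 (α + t * Complex.I)) =
      Complex.I * ((∫ y in α..β, dslope g 1 (y + (((-1) * T : ℝ) : ℂ) * Complex.I)) -
        ∫ y in α..β, dslope g 1 (y + ((1 * T : ℝ) : ℂ) * Complex.I)) := by
    intro T
    have := Complex.integral_boundary_rect_eq_zero_of_differentiableOn (dslope g 1)
      (α + (-T : ℝ) * Complex.I) (β + T * Complex.I) hd.differentiableOn
    simp only [Complex.add_re, Complex.ofReal_re, Complex.mul_re, Complex.I_re, mul_zero,
      Complex.ofReal_im, Complex.I_im, mul_one, sub_self, add_zero, Complex.add_im,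
      Complex.mul_im, zero_add, smul_eq_mul] at this
    rw [neg_one_mul, one_mul]
    linear_combination (-Complex.I) * this + ((∫ t in (-T)..T, dslope g 1 (β + t * Complex.I)) -
      (∫ t in (-T)..T, dslope g 1 (α + t * Complex.I))) * Complex.I_sq
  have hint : ∀ γ : ℝ, γ ≠ 1 → ∀ T : ℝ,
      (∫ t in (-T)..T, g (γ + t * Complex.I) / (γ + t * Complex.I - 1)) =
      (∫ t in (-T)..T, dslope g 1 (γ + t * Complex.I)) +
        g 1 * ∫ t in (-T)..T, (((γ - 1 : ℝ) : ℂ) + t * Complex.I)⁻¹ := by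
    intro γ hγ T
    have h0 : ∀ t : ℝ, ((γ - 1 : ℝ) : ℂ) + t * Complex.I ≠ 0 := fun t h => by
      have := congrArg Complex.re h
      simp at this
      exact hγ (by linarith)
    rw [← intervalIntegral.integral_const_mul, ← intervalIntegral.integral_add]
    · refine intervalIntegral.integral_congr fun t _ => ?_
      have h1 : (γ + t * Complex.I : ℂ) - 1 = ((γ - 1 : ℝ) : ℂ) + t * Complex.I := by
        push_cast; ring
      have h2 : (γ + t * Complex.I : ℂ) ≠ 1 := by
        rw [← sub_ne_zero, h1]; exact h0 t
      rw [hds _ h2, ← h1]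
      have := sub_ne_zero.mpr h2
      field_simp
      ring
    · exact (hd.continuous.comp (by fun_prop)).intervalIntegrable _ _
    · exact (continuous_const.mul (Continuous.inv₀ (by fun_prop) h0)).intervalIntegrable _ _
  have hv := (tendsto_integral_inv_add_mul_I (sub_ne_zero.mpr hβ.ne')).sub
    (tendsto_integral_inv_add_mul_I (sub_ne_zero.mpr hα.ne))
  have := (((hor (-1) (by simp)).sub (hor 1 (by simp))).const_mul Complex.I).add
    (hv.const_mul (g 1))
  refine (this.congr fun T => ?_).trans_eq ?_
  · rw [hint β hβ.ne', hint α hα.ne, ← hrect]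
    ring
  · rw [sign_pos (by linarith), sign_neg (by linarith)]
    congr 1
    simp; ring

theorem hasSum_pow_mul_cos {r : ℝ} (hr : |r| < 1) (θ : ℝ) :
    HasSum (fun n : ℕ => r ^ (n + 1) * Real.cos (θ * (n + 1)))
      ((r * Real.cos θ - r ^ 2) / (1 - 2 * r * Real.cos θ + r ^ 2)) := by
  set z : ℂ := r * Complex.exp (θ * Complex.I) with hz
  have hz1 : ‖z‖ < 1 := by simpa [hz, Complex.norm_exp_ofReal_mul_I] using hr
  have h := Complex.hasSum_re ((hasSum_geometric_of_norm_lt_one hz1).mul_left z)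
  have e1 : ∀ n : ℕ, (z * z ^ n).re = r ^ (n + 1) * Real.cos (θ * (n + 1)) := fun n => by
    rw [← pow_succ', hz, mul_pow, ← Complex.exp_nat_mul, ← Complex.ofReal_pow,
      Complex.re_ofReal_mul, show ((n + 1 : ℕ) : ℂ) * (θ * Complex.I) =
        ((θ * (n + 1) : ℝ) : ℂ) * Complex.I by push_cast; ring, Complex.exp_ofReal_mul_I_re]
  have hre : z.re = r * Real.cos θ := by
    rw [hz, Complex.re_ofReal_mul, Complex.exp_ofReal_mul_I_re]
  have him : z.im = r * Real.sin θ := by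
    rw [hz, Complex.im_ofReal_mul, Complex.exp_ofReal_mul_I_im]
  have hns : Complex.normSq (1 - z) = 1 - 2 * r * Real.cos θ + r ^ 2 := by
    rw [Complex.normSq_apply]
    simp only [Complex.sub_re, Complex.one_re, Complex.sub_im, Complex.one_im, hre, him]
    linear_combination r ^ 2 * Real.sin_sq_add_cos_sq θ
  have e2 : (z * (1 - z)⁻¹).re =
      (r * Real.cos θ - r ^ 2) / (1 - 2 * r * Real.cos θ + r ^ 2) := by
    rw [Complex.mul_re, Complex.inv_re, Complex.inv_im, hns]
    simp only [Complex.sub_re, Complex.one_re, Complex.sub_im, Complex.one_im, hre, him]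
    rw [mul_div_assoc', mul_div_assoc', ← sub_div]
    congr 1
    linear_combination (-r ^ 2) * Real.sin_sq_add_cos_sq θ
  rw [e2] at h
  simpa only [e1] using h

theorem coe_unitAddCircle_ne_zero {a : ℝ} (ha0 : 0 < a) (ha1 : a < 1) :
    (a : UnitAddCircle) ≠ 0 := fun h => by
  obtain ⟨n, hn⟩ := (AddCircle.coe_eq_zero_iff (1 : ℝ)).mp h
  rw [zsmul_one] at hn
  rw [← hn] at ha0 ha1
  have h0 : 0 < n := by exact_mod_cast ha0
  have h1 : n < 1 := by exact_mod_cast ha1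
  omega

/-- `∑ cos(2πna) / n = -log (2 sin πa)`, the series being understood by analytic continuation. -/
theorem cosZeta_one {a : ℝ} (ha0 : 0 < a) (ha1 : a < 1) :
    HurwitzZeta.cosZeta a 1 = -(Real.log (2 * Real.sin (π * a)) : ℂ) := by
  have ha := coe_unitAddCircle_ne_zero ha0 ha1
  set c := Real.cos (2 * π * a) with hc
  have hsin : 0 < Real.sin (π * a) :=
    Real.sin_pos_of_pos_of_lt_pi (by positivity) (by nlinarith [Real.pi_pos])
  have hc2 : c = 1 - 2 * Real.sin (π * a) ^ 2 := by
    rw [hc, mul_assoc, Real.cos_two_mul, Real.cos_sq']; ring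
  have hc1 : c < 1 := by nlinarith
  have hcm : -1 ≤ c := Real.neg_one_le_cos _
  have hd : ∀ r : ℝ, 0 ≤ r → (1 - c) / 4 ≤ 1 - 2 * r * c + r ^ 2 := fun r hr => by
    nlinarith [mul_nonneg hr (by linarith : 0 ≤ 1 - c), sq_nonneg (1 - r),
      mul_nonneg (by linarith : 0 ≤ 1 + c) (sq_nonneg (1 - r)), mul_nonneg hr hr]
  have hd0 : ∀ t : ℝ, 0 < 1 - 2 * Real.exp (-t) * c + Real.exp (-t) ^ 2 := fun t =>
    lt_of_lt_of_le (by linarith) (hd _ (Real.exp_pos _).le)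
  set F : ℝ → ℝ := fun t =>
    (Real.exp (-t) * c - Real.exp (-t) ^ 2) / (1 - 2 * Real.exp (-t) * c + Real.exp (-t) ^ 2)
    with hF
  have hFc : Continuous F := by
    rw [hF]
    exact Continuous.div (by fun_prop) (by fun_prop) fun t => (hd0 t).ne'
  have hFb : ∀ t : ℝ, 0 ≤ t → ‖(F t : ℂ)‖ ≤ 8 / (1 - c) * Real.exp (-t) := by
    intro t ht
    have hr1 : Real.exp (-t) ≤ 1 := Real.exp_le_one_iff.mpr (by linarith)
    have hr0 := Real.exp_pos (-t)
    have := hd _ hr0.le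
    rw [Complex.norm_real, hF, Real.norm_eq_abs, abs_div, abs_of_pos (hd0 t), div_le_iff₀ (hd0 t)]
    calc _ ≤ 2 * Real.exp (-t) := by
          rw [abs_le]
          constructor <;> nlinarith
      _ = 8 / (1 - c) * Real.exp (-t) * ((1 - c) / 4) := by
          have : 1 - c ≠ 0 := by linarith
          field_simp
          norm_num
      _ ≤ _ := by
          have : 0 < 1 - c := by linarith
          gcongr
  have hloc : MeasureTheory.LocallyIntegrableOn (fun t => (F t : ℂ)) (Set.Ioi 0) :=
    (Complex.continuous_ofReal.comp hFc).locallyIntegrable.locallyIntegrableOn _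
  have htop : (fun t => (F t : ℂ)) =O[atTop] fun t => Real.exp (-1 * t) := by
    refine IsBigO.of_bound (8 / (1 - c)) ?_
    filter_upwards [eventually_ge_atTop 0] with t ht
    rw [Real.norm_eq_abs, Real.abs_exp, neg_one_mul]
    exact hFb t ht
  have hbot : (fun t => (F t : ℂ)) =O[𝓝[>] 0] fun t : ℝ => t ^ (-0 : ℝ) := by
    simp only [neg_zero, Real.rpow_zero]
    exact ((Complex.continuous_ofReal.comp hFc).tendsto 0).isBigO_one ℝ |>.mono nhdsWithin_le_nhds
  have hmell : ∀ s : ℂ, 1 < s.re → mellin (fun t => (F t : ℂ)) s =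
      Complex.Gamma s * HurwitzZeta.cosZeta a s := by
    intro s hs
    have hs0 : s ≠ 0 := fun h => by simp [h] at hs; linarith
    have h1 := (hasSum_nat_add_iff' 1).mpr (HurwitzZeta.hasSum_nat_cosZeta a hs)
    have h2 := hasSum_mellin (a := fun n : ℕ => (Real.cos (2 * π * a * (n + 1)) : ℂ))
      (p := fun n : ℕ => (n : ℝ) + 1) (F := fun t => (F t : ℂ)) (s := s)
      (fun n => Or.inr (by positivity)) (by linarith) (fun t ht => ?_) ?_
    · simp only [Finset.range_one, Finset.sum_singleton, Nat.cast_zero, Complex.zero_cpow hs0,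
        div_zero, sub_zero] at h1
      refine h2.unique ((h1.mul_left (Complex.Gamma s)).congr_fun fun n => ?_)
      push_cast
      rw [mul_div_assoc]
    · have hr : |Real.exp (-t)| < 1 := by
        rw [Real.abs_exp, Real.exp_lt_one_iff]; simpa using ht
      refine (Complex.hasSum_ofReal.mpr (hasSum_pow_mul_cos hr (2 * π * a))).congr_fun fun n => ?_
      rw [← Real.exp_nat_mul]
      push_cast
      rw [mul_comm]
      congr 2
      ring
    · have := (summable_nat_add_iff 1).mpr (Real.summable_one_div_nat_rpow.mpr hs)
      refine this.of_nonneg_of_le (fun n => by positivity) fun n => ?_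
      rw [Complex.norm_real, Nat.cast_add_one]
      gcongr
      exact Real.abs_cos_le_one _
  have hcm1 : ContinuousAt (mellin fun t => (F t : ℂ)) 1 :=
    (mellin_differentiableAt_of_isBigO_rpow_exp one_pos hloc htop hbot (by simp)).continuousAt
  have hG1 : ContinuousAt (fun s => Complex.Gamma s * HurwitzZeta.cosZeta a s) 1 := by
    refine ContinuousAt.mul (Complex.differentiableAt_Gamma _ fun m h => ?_).continuousAt
      (HurwitzZeta.differentiable_cosZeta_of_ne_zero ha).continuous.continuousAt
    have := congrArg Complex.re h
    simp at this
    linarith [m.cast_nonneg (α := ℝ)]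
  have hlim : Tendsto (fun x : ℝ => (x : ℂ)) (𝓝[>] 1) (𝓝 1) :=
    (Complex.continuous_ofReal.tendsto 1).mono_left nhdsWithin_le_nhds
  have heq : mellin (fun t => (F t : ℂ)) 1 = HurwitzZeta.cosZeta a 1 := by
    have := tendsto_nhds_unique ((hcm1.tendsto.comp hlim).congr' ?_) (hG1.tendsto.comp hlim)
    · simpa using this
    · filter_upwards [self_mem_nhdsWithin] with x hx
      exact hmell x (by simpa using hx)
  have hconv : MellinConvergent (fun t => (F t : ℂ)) 1 :=
    mellinConvergent_of_isBigO_rpow_exp one_pos hloc htop hbot (by simp)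
  have hint : MeasureTheory.IntegrableOn F (Set.Ioi 0) := by
    have := hconv.re
    simpa [MellinConvergent, MeasureTheory.IntegrableOn] using this
  have hderiv : ∀ t ∈ Set.Ici (0 : ℝ), HasDerivAt (fun t =>
      Real.log (1 - 2 * Real.exp (-t) * c + Real.exp (-t) ^ 2) / 2) (F t) t := by
    intro t _
    have he : HasDerivAt (fun t : ℝ => Real.exp (-t)) (-Real.exp (-t)) t := by
      simpa using (hasDerivAt_id' t).fun_neg.exp
    refine ((((he.const_mul 2).mul_const c).const_sub 1 |>.fun_add (he.fun_pow 2)).log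
      (hd0 t).ne' |>.div_const 2).congr_deriv ?_
    rw [hF]
    have := (hd0 t).ne'
    field_simp
    norm_num
    ring
  have hl0 : Tendsto (fun t => Real.log (1 - 2 * Real.exp (-t) * c + Real.exp (-t) ^ 2) / 2) atTop
      (𝓝 0) := by
    have h1 : Tendsto (fun t : ℝ => Real.exp (-t)) atTop (𝓝 0) :=
      Real.tendsto_exp_atBot.comp tendsto_neg_atTop_atBot
    have h2 : Tendsto (fun t : ℝ => 1 - 2 * Real.exp (-t) * c + Real.exp (-t) ^ 2) atTop
        (𝓝 (1 - 2 * 0 * c + 0 ^ 2)) := (((h1.const_mul 2).mul_const c).const_sub 1).add (h1.pow 2)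
    have h3 := (h2.log (by norm_num)).div_const 2
    simpa using h3
  have hval := MeasureTheory.integral_Ioi_of_hasDerivAt_of_tendsto' hderiv hint hl0
  rw [← heq, mellin]
  simp only [sub_self, Complex.cpow_zero, one_smul]
  rw [integral_complex_ofReal, hval]
  have : Real.log (1 - 2 * Real.exp (-0) * c + Real.exp (-0) ^ 2) =
      2 * Real.log (2 * Real.sin (π * a)) := by
    rw [neg_zero, Real.exp_zero, hc2, ← Real.log_rpow (by positivity)]
    congr 1
    norm_num
    ring
  rw [this]
  push_cast
  ring

theorem isBigO_sum_twistedDivisorSum_sub {N : ℕ} [NeZero N] {χ : DirichletCharacter ℂ N}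
    (heven : χ.Even) (hprim : χ.IsPrimitive) (hχ : χ ≠ 1) {a : ℝ} (ha : (a : UnitAddCircle) ≠ 0)
    {ρ : ℝ} (hρ : 1 < ρ) :
    (fun x : ℝ => ∑ n ∈ Finset.Icc 1 ⌊x⌋₊, (((x ^ 2 - (n : ℝ) ^ 2) ^ ρ : ℝ) : ℂ) *
        twistedDivisorSum χ a n - twistedZetaMellin χ a ρ 1 * ((x ^ (1 + 2 * ρ) : ℝ) : ℂ))
      =O[atTop] fun x : ℝ => x ^ ((5 * ρ + 1) / 3) := by
  obtain ⟨C₁, h₁⟩ := exists_norm_integral_twistedZetaMellin_left heven hprim a hρ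
  obtain ⟨C₂, h₂⟩ := exists_norm_twistedZetaMellin_right heven a ρ
  obtain ⟨C₃, h₃⟩ := exists_norm_twistedZetaMellin_strip heven hprim hχ ha hρ
  have hd := differentiable_twistedZetaMellin hχ ha ρ
  have hρ0 : 0 < ρ := one_pos.trans hρ
  set σ := (1 - ρ) / 3 with hσ
  refine IsBigO.of_bound (1 / (2 * π) * C₁) ((eventually_ge_atTop 1).mono fun x hx => ?_)
  have hx0 : 0 < x := one_pos.trans_le hx
  have hx' : (x : ℂ) ≠ 0 := by exact_mod_cast hx0.ne'
  set W : ℂ → ℂ := fun s => twistedZetaMellin χ a ρ s / (s - 1) * (x : ℂ) ^ s with hW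
  have hcpow : Differentiable ℂ fun s : ℂ => (x : ℂ) ^ s := fun s =>
    differentiableAt_id.const_cpow (Or.inl hx')
  have hlim := tendsto_vertical_integral_sub (g := fun s => twistedZetaMellin χ a ρ s * (x : ℂ) ^ s)
    (hd.mul hcpow) (α := σ) (β := 2) (C := C₃ * (x ^ (2 : ℝ)) ^ 2) (by rw [hσ]; linarith)
    one_lt_two fun s h1 h2 => by
      rw [norm_mul, mul_pow, mul_right_comm, Complex.norm_cpow_eq_rpow_re_of_pos hx0]
      have := h₃ s h1 h2
      have h0 := (sq_nonneg _).trans this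
      gcongr
  have hint : MeasureTheory.Integrable fun t : ℝ => W (2 + t * Complex.I) := by
    refine (((integrable_one_add_abs_rpow hρ0).const_mul C₂).mul_const (x ^ (2 : ℝ))).mono'
      (Continuous.aestronglyMeasurable ?_) (Eventually.of_forall fun t => ?_)
    · refine .mul (.div (hd.continuous.comp (by fun_prop)) (by fun_prop) fun t h => ?_)
        (hcpow.continuous.comp (by fun_prop))
      have := congrArg Complex.re h
      norm_num at this
    · rw [norm_mul, Complex.norm_cpow_eq_rpow_re_of_pos hx0]
      have := h₂ t
      simp only [Complex.add_re, Complex.re_ofNat, Complex.mul_re, Complex.ofReal_re,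
        Complex.I_re, mul_zero, Complex.ofReal_im, Complex.I_im, mul_one, sub_self, add_zero]
      gcongr
  have hright := MeasureTheory.intervalIntegral_tendsto_integral hint
    tendsto_neg_atTop_atBot tendsto_id
  have hleft := hright.sub hlim
  have hbound : ‖(∫ t : ℝ, W (2 + t * Complex.I)) -
      2 * π * (twistedZetaMellin χ a ρ 1 * (x : ℂ) ^ (1 : ℂ))‖ ≤ C₁ * x ^ σ := by
    refine le_of_tendsto hleft.norm ((eventually_ge_atTop 0).mono fun T hT => ?_)
    refine le_trans (le_of_eq ?_) (h₁ x T hx0 hT)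
    simp only [hW, Complex.ofReal_ofNat, id, mul_div_right_comm, sub_sub_cancel]
  rw [sum_twistedDivisorSum_eq_integral heven a hρ0 hx0]
  rw [Complex.cpow_one] at hbound
  have hπ : (π : ℂ) ≠ 0 := by exact_mod_cast Real.pi_ne_zero
  have hsplit : ((x ^ (2 * ρ) : ℝ) : ℂ) * (1 / (2 * π) * ∫ t : ℝ, W (2 + t * Complex.I)) -
      twistedZetaMellin χ a ρ 1 * ((x ^ (1 + 2 * ρ) : ℝ) : ℂ) =
      ((x ^ (2 * ρ) * (1 / (2 * π)) : ℝ) : ℂ) * ((∫ t : ℝ, W (2 + t * Complex.I)) -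
      2 * π * (twistedZetaMellin χ a ρ 1 * (x : ℂ))) := by
    rw [Real.rpow_add hx0, Real.rpow_one]
    generalize (∫ t : ℝ, W (2 + t * Complex.I)) = J
    push_cast
    field_simp
  change ‖((x ^ (2 * ρ) : ℝ) : ℂ) * (1 / (2 * π) * ∫ t : ℝ, W (2 + t * Complex.I)) - _‖ ≤ _
  rw [hsplit, norm_mul, Complex.norm_real, Real.norm_of_nonneg (by positivity),
    Real.norm_of_nonneg (by positivity), show (5 * ρ + 1) / 3 = 2 * ρ + σ by rw [hσ]; ring,
    Real.rpow_add hx0]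
  calc _ ≤ x ^ (2 * ρ) * (1 / (2 * π)) * (C₁ * x ^ σ) := by gcongr
    _ = _ := by ring

theorem statement1 (N : ℕ) [NeZero N] (hN : 1 < N) (χ₁ : DirichletCharacter ℂ N)
    (hreal : ∀ a : ZMod N, (χ₁ a).im = 0) (heven : χ₁.Even) (hnp : χ₁ ≠ 1)
    (hprim : χ₁.IsPrimitive)
    (q : ℕ) (hq : q.Prime) (h : ℕ) (hh0 : 0 < h) (hhq : h < q)
    (ρ : ℝ) (hρ : 1 < ρ) :
    (fun x : ℝ =>
        (∑ n ∈ Finset.Icc 1 ⌊x⌋₊, (((x ^ 2 - (n : ℝ) ^ 2) ^ ρ : ℝ) : ℂ) *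
            ∑ r ∈ n.divisors, divisorSumChar χ₁ (n / r) * (Real.cos (2 * π * r * h / q) : ℂ))
          - (-(Real.sqrt π * Real.Gamma (ρ + 1)) / (2 * Real.Gamma (ρ + 3 / 2)) *
              DirichletCharacter.LFunction χ₁ 1 *
              (Real.log (2 * Real.sin (π * h / q)) : ℂ) * ((x ^ (1 + 2 * ρ) : ℝ) : ℂ)))
      =O[atTop] fun x : ℝ => x ^ ((5 * ρ + 1) / 3) := by
  have hq0 : (0 : ℝ) < q := by exact_mod_cast hh0.trans hhq
  have ha0 : (0 : ℝ) < h / q := div_pos (by exact_mod_cast hh0) hq0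
  have ha1 : (h / q : ℝ) < 1 := (div_lt_one hq0).mpr (by exact_mod_cast hhq)
  refine (isBigO_sum_twistedDivisorSum_sub heven hprim hnp
    (coe_unitAddCircle_ne_zero ha0 ha1) hρ).congr_left fun x => ?_
  have hcos : ∀ r : ℕ, 2 * π * (h / q : ℝ) * r = 2 * π * r * h / q := fun r => by ring
  simp only [twistedDivisorSum, hcos]
  rw [twistedZetaMellin_one heven, cosZeta_one ha0 ha1, ← mul_div_assoc π]
  push_cast
  ring
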